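/- Let a > 0, b, c ∈ ℝ and T > 0 be real numbers, and set c_g = (π²/(2ζ(3)))^{1/3}. For a positive integer n, let G_n = {(i/n, j/n) : i, j ∈ ℤ}, let U_0 = {p ∈ G_n : p.2 ≥ a·p.1²/2 + b·p.1 + c}, let m = ⌊c_g · T · n^{4/3}⌋, and let U_m = peel^[m](U_0). Then there is an absolute constant C > 0 (independent of a, b, c, T, n) such that for all integers n with n ≥ 3 and n ≥ 3a, setting ε = C·(T·a^{2/3} + a^{−2/3})·log(n/a)/n^{1/3}, the following hold: (i) every point p ∈ G_n with p.2 ≥ a·p.1²/2 + b·p.1 + c + T·a^{1/3} + ε belongs to U_m, and (ii) every point p ∈ U_m satisfies p.2 ≥ a·p.1²/2 + b·p.1 + c + T·a^{1/3} − ε. (In other words, after m grid peeling steps on a grid of spacing 1/n, the resulting grid polygon is within vertical distance ε of the parabola translated upward by T·a^{1/3}, which is the image of the original parabola under the affine curve-shortening flow at time T.) -/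

import Mathlib

/-- One grid peeling step: remove the extreme points of the convex hull. -/
noncomputable def peel (U : Set (ℝ × ℝ)) : Set (ℝ × ℝ) :=
  U \ Set.extremePoints ℝ (convexHull ℝ U)

/-- ζ(3) = Σ_{n ≥ 1} 1/n³. -/
noncomputable def zeta3 : ℝ := ∑' n : ℕ, 1 / ((n : ℝ) + 1) ^ 3

/-- The grid peeling constant c_g = (π²/(2ζ(3)))^{1/3}. -/
noncomputable def cg : ℝ := (Real.pi ^ 2 / (2 * zeta3)) ^ ((1 : ℝ) / 3)

/-- The grid of spacing 1/n. -/
def gridN (n : ℕ) : Set (ℝ × ℝ) :=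
  {p | ∃ i j : ℤ, p = ((i : ℝ) / n, (j : ℝ) / n)}

/-- The grid points on or above the parabola y = a·x²/2 + b·x + c. -/
def parabGrid (a b c : ℝ) (n : ℕ) : Set (ℝ × ℝ) :=
  {p ∈ gridN n | a * p.1 ^ 2 / 2 + b * p.1 + c ≤ p.2}

structure Chain (c : ℤ) (Q P VX VY : ℤ → ℤ) : Prop where
  hc : 0 ≤ c
  pos : ∀ j, 1 ≤ Q j
  le : ∀ j, Q j ≤ 2 * c + 1
  sum : ∀ j, 2 * c + 1 < Q j + Q (j + 1)
  det : ∀ j, Q j * P (j + 1) - P j * Q (j + 1) = 1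
  vx : ∀ j, VX (j + 1) = VX j + (2 * c + 1) / Q (j + 1) * Q (j + 1)
  vy : ∀ j, VY (j + 1) = VY j + (2 * c + 1) / Q (j + 1) * P (j + 1)

/-- displacement of a vertex: first coordinate -/
def dxi (c : ℤ) (Q : ℤ → ℤ) (j : ℤ) : ℕ → ℤ
  | 0 => 0
  | τ + 1 => dxi c Q j τ + (if dxi c Q j τ + c < Q j then Q (j + 1) else 0)
      - (if c < dxi c Q j τ + Q (j + 1) then Q j else 0)

def deta (c : ℤ) (Q P : ℤ → ℤ) (j : ℤ) : ℕ → ℤ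
  | 0 => 0
  | τ + 1 => deta c Q P j τ + (if dxi c Q j τ + c < Q j then P (j + 1) else 0)
      - (if c < dxi c Q j τ + Q (j + 1) then P j else 0)

theorem dxi_range {c : ℤ} {Q P VX VY : ℤ → ℤ} (h : Chain c Q P VX VY) (j : ℤ) (τ : ℕ) :
    -c ≤ dxi c Q j τ ∧ dxi c Q j τ ≤ c := by
  induction τ with
  | zero => have := h.hc; simp [dxi]; omega
  | succ τ ih =>
    have h1 := h.pos j
    have h2 := h.pos (j+1)
    have h3 := h.le j
    have h4 := h.le (j+1)
    have h5 := h.sum j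
    simp only [dxi]
    split_ifs <;> constructor <;> omega

theorem chain_k {c : ℤ} {Q P VX VY : ℤ → ℤ} (h : Chain c Q P VX VY) (j : ℤ) :
    ∃ k : ℤ, Q j + Q (j + 2) = k * Q (j + 1) ∧ P j + P (j + 2) = k * P (j + 1) := by
  have h1 := h.det j
  have h2 := h.det (j+1)
  have e : j + 1 + 1 = j + 2 := by ring
  rw [e] at h2
  refine ⟨Q j * P (j+2) - P j * Q (j+2), ?_, ?_⟩
  · linear_combination Q j * (-h2) - Q (j+2) * h1
  · linear_combination P j * (-h2) - P (j+2) * h1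

/-- floor equality after a firing step -/
theorem floor_eq_aux {q a b s e : ℤ} (hq : 1 ≤ q) (ha1 : s - q < a) (ha2 : a ≤ s)
    (hb1 : s - q < b) (hb2 : b ≤ s) (hab : a + b = s + e * q) : a / q = b / q := by
  have hq0 : 0 < q := by omega
  have A1 := Int.emod_add_mul_ediv a q
  have B1 := Int.emod_add_mul_ediv b q
  have A2 := Int.emod_nonneg a hq0.ne'
  have A3 := Int.emod_lt_of_pos a hq0
  have B2 := Int.emod_nonneg b hq0.ne'
  have B3 := Int.emod_lt_of_pos b hq0
  set x := a / q
  set y := b / q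
  by_contra hne
  rcases lt_or_gt_of_ne hne with hlt | hlt
  · -- x < y
    have hd : y - x = 1 := by
      have : q * (y - x) < 2 * q := by nlinarith
      have : y - x < 2 := by nlinarith
      omega
    have hy : y = x + 1 := by omega
    rw [hy] at B1
    -- s = a + b - e q
    have : q * (2 * x + 1 - e) + (a % q + b % q) = s := by linear_combination A1 + B1 + hab
    -- a = q x + r_a ; s - a in [0,q); s - b in [0,q)
    have k1 : 0 ≤ q * (x + 1 - e) + b % q := by nlinarith
    have k2 : q * (x + 1 - e) + b % q < q := by nlinarith
    have k3 : 0 ≤ q * (x - e) + a % q := by nlinarith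
    have k4 : q * (x - e) + a % q < q := by nlinarith
    have m1 : x + 1 - e > -1 := by nlinarith
    have m2 : x + 1 - e < 1 := by nlinarith
    have m3 : x - e > -1 := by nlinarith
    omega
  · have hd : x - y = 1 := by
      have : q * (x - y) < 2 * q := by nlinarith
      have : x - y < 2 := by nlinarith
      omega
    have hy : x = y + 1 := by omega
    rw [hy] at A1
    have : q * (2 * y + 1 - e) + (a % q + b % q) = s := by linear_combination A1 + B1 + hab
    have k1 : 0 ≤ q * (y + 1 - e) + a % q := by nlinarith
    have k2 : q * (y + 1 - e) + a % q < q := by nlinarith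
    have k3 : 0 ≤ q * (y - e) + b % q := by nlinarith
    have k4 : q * (y - e) + b % q < q := by nlinarith
    have m1 : y + 1 - e > -1 := by nlinarith
    have m2 : y + 1 - e < 1 := by nlinarith
    have m3 : y - e > -1 := by nlinarith
    omega

theorem div_pos_iff_aux {q a : ℤ} (hq : 1 ≤ q) (ha : 0 ≤ a) : a < q ↔ a / q = 0 := by
  constructor
  · intro h; exact Int.ediv_eq_zero_of_lt ha h
  · intro h
    by_contra hh
    have : 1 ≤ a / q := by
      rw [Int.le_ediv_iff_mul_le (by omega)]; omega
    omega

theorem sync {c : ℤ} {Q P VX VY : ℤ → ℤ} (h : Chain c Q P VX VY) (j : ℤ) (τ : ℕ) :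
    (∃ e : ℤ, dxi c Q (j+1) τ - dxi c Q j τ = e * Q (j+1) ∧
      deta c Q P (j+1) τ - deta c Q P j τ = e * P (j+1)) ∧
    (c - dxi c Q j τ) / Q (j+1) = (c + dxi c Q (j+1) τ) / Q (j+1) := by
  induction τ with
  | zero => exact ⟨⟨0, by simp [dxi], by simp [deta]⟩, by simp [dxi]⟩
  | succ τ ih =>
    obtain ⟨⟨e, he1, he2⟩, hm⟩ := ih
    have r1 := dxi_range h j τ
    have r2 := dxi_range h (j+1) τ
    have p0 := h.pos j
    have p1 := h.pos (j+1)
    have p2 := h.pos (j+2)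
    have s0 := h.sum j
    have s1 := h.sum (j+1)
    have l0 := h.le j
    have l2 := h.le (j+2)
    have l1 := h.le (j+1)
    obtain ⟨k, hk1, hk2⟩ := chain_k h j
    have ee : j + 1 + 1 = j + 2 := by ring
    rw [ee] at s1
    have i1 := div_pos_iff_aux p1 (a := c - dxi c Q j τ) (by omega)
    have i2 := div_pos_iff_aux p1 (a := c + dxi c Q (j+1) τ) (by omega)
    have iff1 : c < dxi c Q j τ + Q (j+1) ↔ dxi c Q (j+1) τ + c < Q (j+1) := by
      constructor
      · intro hh
        have := i1.1 (by omega)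
        have := i2.2 (by omega)
        omega
      · intro hh
        have := i2.1 (by omega)
        have := i1.2 (by omega)
        omega
    simp only [dxi, deta, ee]
    generalize dxi c Q j τ = x0 at *
    generalize dxi c Q (j+1) τ = x1 at *
    generalize deta c Q P j τ = y0 at *
    generalize deta c Q P (j+1) τ = y1 at *
    generalize Q j = q0 at *
    generalize Q (j+1) = q1 at *
    generalize Q (j+2) = q2 at *
    generalize P j = a0 at *
    generalize P (j+1) = a1 at *
    generalize P (j+2) = a2 at *
    by_cases hf : x1 + c < q1
    · have hf' := iff1.2 hf
      simp only [hf, hf', if_true]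
      have hE : ∃ e : ℤ, x1 + q2 - (if c < x1 + q2 then q1 else 0) -
          (x0 + (if x0 + c < q0 then q1 else 0) - q0) = e * q1 ∧
          y1 + a2 - (if c < x1 + q2 then a1 else 0) -
          (y0 + (if x0 + c < q0 then a1 else 0) - a0) = e * a1 := by
        refine ⟨e + k - (if c < x1 + q2 then 1 else 0) - (if x0 + c < q0 then 1 else 0), ?_, ?_⟩
        · split_ifs <;> linear_combination he1 + hk1
        · split_ifs <;> linear_combination he2 + hk2
      refine ⟨hE, ?_⟩
      obtain ⟨e', he', -⟩ := hE
      apply floor_eq_aux (s := 2 * c) (e := e') p1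
      · split_ifs <;> omega
      · split_ifs <;> omega
      · split_ifs <;> omega
      · split_ifs <;> omega
      · linear_combination he'
    · have hf' : ¬ c < x0 + q1 := fun hh => hf (iff1.1 hh)
      have g1 : c < x1 + q2 := by omega
      have g2 : x0 + c < q0 := by omega
      simp only [hf, hf', if_false, g1, g2, if_true]
      refine ⟨⟨e - 2, by linear_combination he1, by linear_combination he2⟩, ?_⟩
      have t1 : c - (x0 + q1 - 0) = (c - x0) + q1 * (-1) := by ring
      have t2 : c + (x1 + 0 - q1) = (c + x1) + q1 * (-1) := by ring
      rw [t1, t2, Int.add_mul_ediv_left _ _ (by omega), Int.add_mul_ediv_left _ _ (by omega), hm]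

/-- firing indicator of direction j -/
def fire (c : ℤ) (Q : ℤ → ℤ) (j : ℤ) (τ : ℕ) : Prop := dxi c Q j τ + c < Q j

theorem fire_iff {c : ℤ} {Q P VX VY : ℤ → ℤ} (h : Chain c Q P VX VY) (j : ℤ) (τ : ℕ) :
    fire c Q (j+1) τ ↔ c < dxi c Q j τ + Q (j+1) := by
  have hm := (sync h j τ).2
  have r1 := dxi_range h j τ
  have r2 := dxi_range h (j+1) τ
  have p1 := h.pos (j+1)
  have i1 := div_pos_iff_aux p1 (a := c - dxi c Q j τ) (by omega)
  have i2 := div_pos_iff_aux p1 (a := c + dxi c Q (j+1) τ) (by omega)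
  unfold fire
  constructor
  · intro hh
    have := i2.1 (by omega)
    have := i1.2 (by omega)
    omega
  · intro hh
    have := i1.1 (by omega)
    have := i2.2 (by omega)
    omega

theorem fire_or {c : ℤ} {Q P VX VY : ℤ → ℤ} (h : Chain c Q P VX VY) (j : ℤ) (τ : ℕ) :
    fire c Q j τ ∨ fire c Q (j+1) τ := by
  rw [fire_iff h]
  unfold fire
  have s0 := h.sum j
  omega

def zx (c : ℤ) (Q VX : ℤ → ℤ) (j : ℤ) (τ : ℕ) : ℤ := VX j + dxi c Q j τ
def zy (c : ℤ) (Q P VY : ℤ → ℤ) (j : ℤ) (τ : ℕ) : ℤ := VY j + deta c Q P j τ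
def Lev (c : ℤ) (Q P VX VY : ℤ → ℤ) (j : ℤ) (τ : ℕ) : ℤ :=
  Q j * zy c Q P VY j τ - P j * zx c Q VX j τ

open Classical in
theorem Lev_succ {c : ℤ} {Q P VX VY : ℤ → ℤ} (h : Chain c Q P VX VY) (j : ℤ) (τ : ℕ) :
    Lev c Q P VX VY j (τ+1) = Lev c Q P VX VY j τ + if fire c Q j τ then 1 else 0 := by
  have hd := h.det j
  unfold Lev zx zy fire
  simp only [dxi, deta]
  split_ifs
  · linear_combination hd
  · linear_combination hd
  · ring
  · ring

/-- edge lengths -/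
theorem edge {c : ℤ} {Q P VX VY : ℤ → ℤ} (h : Chain c Q P VX VY) (j : ℤ) (τ : ℕ) :
    ∃ l : ℤ, 0 ≤ l ∧ (fire c Q (j+1) τ → l ≤ 1) ∧
      zx c Q VX (j+1) τ = zx c Q VX j τ + l * Q (j+1) ∧
      zy c Q P VY (j+1) τ = zy c Q P VY j τ + l * P (j+1) := by
  obtain ⟨⟨e, he1, he2⟩, hm⟩ := sync h j τ
  have r1 := dxi_range h j τ
  have r2 := dxi_range h (j+1) τ
  have p1 := h.pos (j+1)
  have i2 := div_pos_iff_aux p1 (a := c + dxi c Q (j+1) τ) (by omega)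
  have hx := h.vx j
  have hy := h.vy j
  have hq0 : 0 < Q (j+1) := by omega
  refine ⟨(2 * c + 1) / Q (j+1) + e, ?_, ?_, ?_, ?_⟩
  · rw [← Int.add_mul_ediv_right _ _ hq0.ne']
    apply Int.ediv_nonneg _ hq0.le
    linarith
  · intro hf
    unfold fire at hf
    have m0 := i2.1 (by omega)
    rw [m0] at hm
    have := (div_pos_iff_aux p1 (a := c - dxi c Q j τ) (by omega)).2 hm
    rw [← Int.add_mul_ediv_right _ _ hq0.ne']
    have : (2 * c + 1 + e * Q (j+1)) / Q (j+1) < 2 := by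
      rw [Int.ediv_lt_iff_lt_mul hq0]
      linarith
    omega
  · unfold zx; linear_combination hx + he1
  · unfold zy; linear_combination hy + he2

theorem dxi_congr {c : ℤ} {Q : ℤ → ℤ} {j : ℤ} {a b : ℕ} (h : dxi c Q j a = dxi c Q j b) (k : ℕ) :
    dxi c Q j (a + k) = dxi c Q j (b + k) := by
  induction k with
  | zero => exact h
  | succ k ih => rw [← add_assoc, ← add_assoc]; simp only [dxi]; rw [ih]

theorem dxi_inj {c : ℤ} {Q P VX VY : ℤ → ℤ} (h : Chain c Q P VX VY) {j : ℤ} {a b : ℕ}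
    (hab : dxi c Q j (a+1) = dxi c Q j (b+1)) : dxi c Q j a = dxi c Q j b := by
  have r1 := dxi_range h j a
  have r2 := dxi_range h j b
  have h1 := h.pos j
  have h2 := h.pos (j+1)
  have h3 := h.le j
  have h4 := h.le (j+1)
  have h5 := h.sum j
  simp only [dxi] at hab
  split_ifs at hab <;> omega

theorem dxi_inj' {c : ℤ} {Q P VX VY : ℤ → ℤ} (h : Chain c Q P VX VY) {j : ℤ} {a b : ℕ}
    (hab : dxi c Q j a = dxi c Q j (a + b)) : dxi c Q j b = 0 := by
  induction a with
  | zero => rw [zero_add] at hab; rw [← hab]; rfl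
  | succ a ih =>
    apply ih
    apply dxi_inj h
    rw [hab]; congr 1; ring

theorem dsum {c : ℤ} {Q P : ℤ → ℤ} {j : ℤ} (n : ℕ) :
    dxi c Q j n = ((Finset.range n).filter (fun k => dxi c Q j k + c < Q j)).card * Q (j+1) -
      ((Finset.range n).filter (fun k => c < dxi c Q j k + Q (j+1))).card * Q j ∧
    deta c Q P j n = ((Finset.range n).filter (fun k => dxi c Q j k + c < Q j)).card * P (j+1) -
      ((Finset.range n).filter (fun k => c < dxi c Q j k + Q (j+1))).card * P j := by
  induction n with
  | zero => simp [dxi, deta]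
  | succ n ih =>
    obtain ⟨i1, i2⟩ := ih
    simp only [dxi, deta, Finset.range_add_one, Finset.filter_insert]
    constructor
    · split_ifs <;> (try simp) <;> linear_combination i1
    · split_ifs <;> (try simp) <;> linear_combination i2

theorem dsp_period {c : ℤ} {Q P VX VY : ℤ → ℤ} (h : Chain c Q P VX VY) (j : ℤ) (t : ℕ)
    (ht : (t : ℤ) = 2 * c + 1) : dxi c Q j t = 0 ∧ deta c Q P j t = 1 := by
  have h1 := h.pos j
  have h2 := h.pos (j+1)
  have h3 := h.le j
  have h4 := h.le (j+1)
  have h5 := h.sum j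
  have hex : ∃ n : ℕ, 0 < n ∧ dxi c Q j n = 0 := by
    have hm : ∀ a ∈ Finset.range (t+1), dxi c Q j a ∈ Finset.Icc (-c) c := by
      intro a _; rw [Finset.mem_Icc]; exact dxi_range h j a
    have hcard : (Finset.Icc (-c) c).card < (Finset.range (t+1)).card := by
      simp; omega
    obtain ⟨a, -, b, -, hne, hab⟩ := Finset.exists_ne_map_eq_of_card_lt_of_maps_to hcard hm
    rcases lt_or_gt_of_ne hne with hlt | hlt
    · refine ⟨b - a, by omega, dxi_inj' h (a := a) ?_⟩
      rw [hab]; congr 1; omega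
    · refine ⟨a - b, by omega, dxi_inj' h (a := b) ?_⟩
      rw [← hab]; congr 1; omega
  classical
  set n := Nat.find hex with hn
  obtain ⟨hn0, hnz⟩ := Nat.find_spec hex
  rw [← hn] at hn0 hnz
  have hmin : ∀ k, 0 < k → k < n → dxi c Q j k ≠ 0 := by
    intro k hk hkn hz
    exact Nat.find_min hex hkn ⟨hk, hz⟩
  have hinj : Set.InjOn (dxi c Q j) (Finset.range n : Finset ℕ) := by
    intro a ha b hb hab
    simp only [Finset.coe_range, Set.mem_Iio] at ha hb
    by_contra hne
    rcases lt_or_gt_of_ne hne with hlt | hlt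
    · apply hmin (b - a) (by omega) (by omega)
      apply dxi_inj' h (a := a)
      rw [hab]; congr 1; omega
    · apply hmin (a - b) (by omega) (by omega)
      apply dxi_inj' h (a := b)
      rw [← hab]; congr 1; omega
  obtain ⟨sx, sy⟩ := dsum (c := c) (Q := Q) (P := P) (j := j) n
  set FA := (Finset.range n).filter (fun k => dxi c Q j k + c < Q j) with hFA
  set FB := (Finset.range n).filter (fun k => c < dxi c Q j k + Q (j+1)) with hFB
  have cA : (FA.card : ℤ) ≤ Q j := by
    have : FA.card ≤ (Finset.Ico (-c) (Q j - c)).card := by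
      apply Finset.card_le_card_of_injOn (dxi c Q j)
      · intro k hk
        have := dxi_range h j k
        simp [hFA] at hk
        simp; omega
      · exact hinj.mono (by intro k; simp [hFA]; tauto)
    simp at this; omega
  have cB : (FB.card : ℤ) ≤ Q (j+1) := by
    have : FB.card ≤ (Finset.Ioc (c - Q (j+1)) c).card := by
      apply Finset.card_le_card_of_injOn (dxi c Q j)
      · intro k hk
        have := dxi_range h j k
        simp [hFB] at hk
        simp; omega
      · exact hinj.mono (by intro k; simp [hFB]; tauto)
    simp at this; omega
  have cI : ((FA ∩ FB).card : ℤ) ≤ Q j + Q (j+1) - (2*c+1) := by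
    have : (FA ∩ FB).card ≤ (Finset.Ioo (c - Q (j+1)) (Q j - c)).card := by
      apply Finset.card_le_card_of_injOn (dxi c Q j)
      · intro k hk
        simp [hFB, hFA] at hk
        simp; omega
      · exact hinj.mono (by intro k; simp [hFA]; tauto)
    simp at this; omega
  have cn : (n : ℤ) ≤ 2 * c + 1 := by
    have : (Finset.range n).card ≤ (Finset.Icc (-c) c).card := by
      apply Finset.card_le_card_of_injOn (dxi c Q j)
      · intro k hk
        have := dxi_range h j k
        simp; omega
      · exact hinj
    simp at this; omega
  have cU : FA ∪ FB = Finset.range n := by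
    ext k
    simp [hFA, hFB]
    omega
  have cc := Finset.card_union_add_card_inter FA FB
  rw [cU, Finset.card_range] at cc
  rw [hnz] at sx
  have cop : IsCoprime (Q j) (Q (j+1)) := ⟨P (j+1), - P j, by linear_combination h.det j⟩
  have dv : Q j ∣ (FA.card : ℤ) := by
    apply cop.dvd_of_dvd_mul_right
    exact ⟨FB.card, by linear_combination -sx⟩
  have posA : 0 < (FA.card : ℤ) := by
    by_contra hh
    have h0 : (FA.card : ℤ) = 0 := by omega
    rw [h0] at sx
    have : (FB.card : ℤ) = 0 := by
      have : (FB.card : ℤ) * Q j = 0 := by linarith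
      rcases mul_eq_zero.1 this with h | h
      · exact h
      · omega
    omega
  have eA : (FA.card : ℤ) = Q j := le_antisymm cA (Int.le_of_dvd posA dv)
  have eB : (FB.card : ℤ) = Q (j+1) := by
    rw [eA] at sx
    have : Q j * ((FB.card : ℤ) - Q (j+1)) = 0 := by linear_combination sx
    rcases mul_eq_zero.1 this with h | h <;> omega
  have hnt : n = t := by omega
  rw [← hnt]
  refine ⟨hnz, ?_⟩
  rw [sy, eA, eB]
  linear_combination h.det j

theorem dsp_add {c : ℤ} {Q P VX VY : ℤ → ℤ} (h : Chain c Q P VX VY) (j : ℤ) (t : ℕ)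
    (ht : (t : ℤ) = 2 * c + 1) (τ : ℕ) :
    dxi c Q j (τ + t) = dxi c Q j τ ∧ deta c Q P j (τ + t) = deta c Q P j τ + 1 := by
  induction τ with
  | zero => simpa [dxi, deta] using dsp_period h j t ht
  | succ τ ih =>
    have : τ + 1 + t = (τ + t) + 1 := by ring
    rw [this]
    simp only [dxi, deta]
    rw [ih.1, ih.2]
    exact ⟨rfl, by ring⟩

theorem dsp_mul {c : ℤ} {Q P VX VY : ℤ → ℤ} (h : Chain c Q P VX VY) (j : ℤ) (t : ℕ)
    (ht : (t : ℤ) = 2 * c + 1) (k : ℕ) :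
    dxi c Q j (t * k) = 0 ∧ deta c Q P j (t * k) = k := by
  induction k with
  | zero => simp [dxi, deta]
  | succ k ih =>
    have := dsp_add h j t ht (t * k)
    rw [mul_add, mul_one, this.1, this.2, ih.1, ih.2]
    simp

structure CS where
  q : ℤ
  p : ℤ
  q' : ℤ
  p' : ℤ
  x : ℤ
  y : ℤ

def cst (t : ℤ) : ℕ → CS
  | 0 => ⟨1, 0, t, 1, 0, 0⟩
  | n + 1 => ⟨(cst t n).q', (cst t n).p', (t + (cst t n).q) / (cst t n).q' * (cst t n).q' - (cst t n).q,
      (t + (cst t n).q) / (cst t n).q' * (cst t n).p' - (cst t n).p,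
      (cst t n).x + t / (cst t n).q' * (cst t n).q', (cst t n).y + t / (cst t n).q' * (cst t n).p'⟩

theorem cst_inv (t : ℤ) (ht : 1 ≤ t) (n : ℕ) : 1 ≤ (cst t n).q ∧ (cst t n).q ≤ t ∧ 1 ≤ (cst t n).q' ∧
    (cst t n).q' ≤ t ∧ t < (cst t n).q + (cst t n).q' ∧
    (cst t n).q * (cst t n).p' - (cst t n).p * (cst t n).q' = 1 := by
  induction n with
  | zero => simp [cst]; omega
  | succ n ih =>
    obtain ⟨h1, h2, h3, h4, h5, h6⟩ := ih
    simp only [cst]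
    generalize (cst t n).q = q at *
    generalize (cst t n).q' = q' at *
    have A := Int.emod_add_mul_ediv (t + q) q'
    have B := Int.emod_nonneg (t + q) (show q' ≠ 0 by omega)
    have C := Int.emod_lt_of_pos (t+q) (show 0 < q' by omega)
    refine ⟨h3, h4, ?_, ?_, ?_, ?_⟩
    · nlinarith
    · nlinarith
    · nlinarith
    · linear_combination h6

def cQ (t : ℤ) : ℤ → ℤ
  | Int.ofNat n => (cst t n).q
  | Int.negSucc n => (cst t (n+1)).q
def cP (t : ℤ) : ℤ → ℤ
  | Int.ofNat n => (cst t n).p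
  | Int.negSucc n => -(cst t (n+1)).p
def cVX (t : ℤ) : ℤ → ℤ
  | Int.ofNat n => (cst t n).x
  | Int.negSucc n => -t - (cst t n).x
def cVY (t : ℤ) : ℤ → ℤ
  | Int.ofNat n => (cst t n).y
  | Int.negSucc n => (cst t n).y

theorem cst_q' (t : ℤ) (n : ℕ) : (cst t n).q' = (cst t (n+1)).q := rfl
theorem cst_p' (t : ℤ) (n : ℕ) : (cst t n).p' = (cst t (n+1)).p := rfl

theorem ofNat_succ' (n : ℕ) : Int.ofNat n + 1 = Int.ofNat (n+1) := by simp
theorem negSucc_succ' (n : ℕ) : Int.negSucc (n+1) + 1 = Int.negSucc n := by omega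
theorem negSucc_zero' : Int.negSucc 0 + 1 = Int.ofNat 0 := by simp

theorem cchain (c : ℤ) (hc : 0 ≤ c) :
    Chain c (cQ (2*c+1)) (cP (2*c+1)) (cVX (2*c+1)) (cVY (2*c+1)) := by
  have I := cst_inv (2*c+1) (by omega)
  refine ⟨hc, ?_, ?_, ?_, ?_, ?_, ?_⟩
  · rintro (n | n)
    · exact (I n).1
    · exact (I (n+1)).1
  · rintro (n | n)
    · exact (I n).2.1
    · exact (I (n+1)).2.1
  · rintro (n | (_ | n))
    · rw [ofNat_succ']; exact (I n).2.2.2.2.1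
    · rw [negSucc_zero']; have := (I 0).2.2.2.2.1; simp [cQ, cst] at *
    · rw [negSucc_succ']; have := (I (n+1)).2.2.2.2.1; rw [cst_q'] at this; simp only [cQ]; omega
  · rintro (n | (_ | n))
    · rw [ofNat_succ']; exact (I n).2.2.2.2.2
    · rw [negSucc_zero']; have := (I 0).2.2.2.2.1; simp [cQ, cP, cst] at *
    · rw [negSucc_succ']; have := (I (n+1)).2.2.2.2.2; rw [cst_q', cst_p'] at this; simp only [cQ, cP]
      linear_combination this
  · rintro (n | (_ | n))
    · rw [ofNat_succ']; rfl
    · rw [negSucc_zero']; simp [cQ, cVX, cst]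
    · rw [negSucc_succ']; simp only [cQ, cVX]; rw [cst]; simp only [cst_q']; ring
  · rintro (n | (_ | n))
    · rw [ofNat_succ']; rfl
    · rw [negSucc_zero']; simp [cQ, cVY, cP, cst]
    · rw [negSucc_succ']; simp only [cQ, cVY, cP]; rw [cst]; simp only [cst_q', cst_p']; ring

theorem cQ_zero (t : ℤ) : cQ t 0 = 1 := rfl
theorem cP_zero (t : ℤ) : cP t 0 = 0 := rfl
theorem cVX_zero (t : ℤ) : cVX t 0 = 0 := rfl
theorem cVY_zero (t : ℤ) : cVY t 0 = 0 := rfl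
theorem cQ_neg (t : ℤ) (k : ℕ) : cQ t (-(k:ℤ)) = cQ t k := by
  cases k with
  | zero => rfl
  | succ k => rfl
theorem cP_neg (t : ℤ) (k : ℕ) : cP t (-(k:ℤ)) = -cP t k := by
  cases k with
  | zero => rfl
  | succ k => rfl
theorem cVX_neg (t : ℤ) (k : ℕ) : cVX t (-1-(k:ℤ)) = -t - cVX t k := by
  have : (-1 - (k:ℤ)) = Int.negSucc k := by omega
  rw [this]; rfl
theorem cVY_neg (t : ℤ) (k : ℕ) : cVY t (-1-(k:ℤ)) = cVY t k := by
  have : (-1 - (k:ℤ)) = Int.negSucc k := by omega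
  rw [this]; rfl

theorem extreme_of_strict_min (U : Set (ℝ × ℝ)) (p : ℝ × ℝ) (L : ℝ × ℝ →ₗ[ℝ] ℝ) (hp : p ∈ U)
    (h : ∀ u ∈ U, u ≠ p → L p < L u) : p ∈ Set.extremePoints ℝ (convexHull ℝ U) := by
  have hconv : Convex ℝ {u : ℝ × ℝ | u = p ∨ L p < L u} := by
    rw [convex_iff_forall_pos]
    rintro x hx y hy a b ha hb hab
    simp only [Set.mem_ofPred_eq] at *
    rcases hx with rfl | hx
    · rcases hy with rfl | hy
      · left; rw [← add_smul, hab, one_smul]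
      · right
        rw [map_add, map_smul, map_smul, smul_eq_mul, smul_eq_mul]
        have : L x = a * L x + b * L x := by rw [← add_mul, hab, one_mul]
        nlinarith
    · right
      rw [map_add, map_smul, map_smul, smul_eq_mul, smul_eq_mul]
      have e : L p = a * L p + b * L p := by rw [← add_mul, hab, one_mul]
      have : L p ≤ L y := by
        rcases hy with rfl | hy
        · exact le_rfl
        · exact hy.le
      nlinarith
  have hsub : convexHull ℝ U ⊆ {u : ℝ × ℝ | u = p ∨ L p < L u} := by
    apply convexHull_min _ hconv
    intro u hu
    by_cases hup : u = p
    · left; exact hup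
    · right; exact h u hu hup
  rw [mem_extremePoints]
  refine ⟨subset_convexHull ℝ U hp, ?_⟩
  rintro x hx y hy ⟨a, b, ha, hb, hab, he⟩
  have hx' := hsub hx
  have hy' := hsub hy
  simp only [Set.mem_ofPred_eq] at hx' hy'
  have e : L p = a * L p + b * L p := by rw [← add_mul, hab, one_mul]
  have e2 : L p = a * L x + b * L y := by
    rw [← he, map_add, map_smul, map_smul, smul_eq_mul, smul_eq_mul]
  have lx : L p ≤ L x := by
    rcases hx' with rfl | h
    · exact le_rfl
    · exact h.le
  have ly : L p ≤ L y := by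
    rcases hy' with rfl | h
    · exact le_rfl
    · exact h.le
  constructor
  · rcases hx' with h | h
    · exact h
    · exfalso; nlinarith
  · rcases hy' with h | h
    · exact h
    · exfalso; nlinarith

theorem not_extreme_aux (U : Set (ℝ × ℝ)) (p A B : ℝ × ℝ) (δ : ℝ) (hδ : 0 < δ)
    (hA : A ∈ U) (hB : B ∈ U) (hpd : (p.1, p.2 + δ) ∈ U)
    (h1 : A.1 ≤ p.1) (h2 : p.1 ≤ B.1) (hAB : A.1 < B.1) (hpA : p ≠ A) (hpB : p ≠ B)
    (hab : (B.2 - A.2) * (p.1 - A.1) ≤ (p.2 - A.2) * (B.1 - A.1)) :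
    p ∉ Set.extremePoints ℝ (convexHull ℝ U) := by
  intro hext
  rw [mem_extremePoints] at hext
  obtain ⟨-, hx⟩ := hext
  have hA' := subset_convexHull ℝ U hA
  have hB' := subset_convexHull ℝ U hB
  have hp' := subset_convexHull ℝ U hpd
  have hd : 0 < B.1 - A.1 := by linarith
  set l := (p.1 - A.1) / (B.1 - A.1) with hl
  have hl1 : l * (B.1 - A.1) = p.1 - A.1 := by rw [hl]; field_simp
  have l0 : 0 ≤ l := by rw [hl]; apply div_nonneg <;> linarith
  have l1 : l ≤ 1 := by rw [hl, div_le_one hd]; linarith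
  set e : ℝ × ℝ := (1 - l) • A + l • B with he
  have hemem : e ∈ convexHull ℝ U :=
    (convex_convexHull ℝ U) hA' hB' (by linarith) l0 (by ring)
  have he1 : e.1 = p.1 := by
    simp only [he, Prod.fst_add, Prod.smul_fst, smul_eq_mul]; linarith
  have he2 : e.2 = A.2 + l * (B.2 - A.2) := by
    simp only [he, Prod.snd_add, Prod.smul_snd, smul_eq_mul]; ring
  have hle : e.2 ≤ p.2 := by
    rw [he2]
    have : (l * (B.2 - A.2)) * (B.1 - A.1) ≤ (p.2 - A.2) * (B.1 - A.1) := by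
      calc _ = (B.2 - A.2) * (l * (B.1 - A.1)) := by ring
        _ ≤ _ := by rw [hl1]; exact hab
    have := le_of_mul_le_mul_right this hd
    linarith
  rcases hle.lt_or_eq with hlt | heq
  · have hs : 0 < p.2 + δ - e.2 := by linarith
    have : p ∈ openSegment ℝ e (p.1, p.2 + δ) := by
      refine ⟨δ / (p.2 + δ - e.2), (p.2 - e.2) / (p.2 + δ - e.2), by positivity,
        div_pos (by linarith) hs, ?_, ?_⟩
      · field_simp; ring
      · ext
        · simp only [Prod.fst_add, Prod.smul_fst, smul_eq_mul]
          rw [he1]; field_simp; ring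
        · simp only [Prod.snd_add, Prod.smul_snd, smul_eq_mul]
          field_simp; ring
    have := (hx e hemem _ hp' this).1
    rw [this] at hlt
    exact lt_irrefl _ hlt
  · have hpe : p = e := by ext; exacts [he1.symm, heq.symm]
    have l0' : 0 < l := by
      rcases l0.lt_or_eq with h | h
      · exact h
      · exfalso; apply hpA; rw [hpe, he, ← h]; simp
    have l1' : l < 1 := by
      rcases l1.lt_or_eq with h | h
      · exact h
      · exfalso; apply hpB; rw [hpe, he, h]; simp
    have := (hx A hA' B hB' ⟨1 - l, l, by linarith, l0', by ring, hpe.symm⟩).1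
    exact hpA this.symm

theorem peel_mono {U V : Set (ℝ × ℝ)} (h : U ⊆ V) : peel U ⊆ peel V := by
  rintro p ⟨hpU, hpe⟩
  refine ⟨h hpU, fun hpV => hpe ?_⟩
  exact inter_extremePoints_subset_extremePoints_of_subset (convexHull_mono h)
    ⟨subset_convexHull ℝ U hpU, hpV⟩

theorem peel_iter_mono {U V : Set (ℝ × ℝ)} (h : U ⊆ V) (m : ℕ) : peel^[m] U ⊆ peel^[m] V := by
  induction m with
  | zero => exact h
  | succ m ih => rw [Function.iterate_succ_apply', Function.iterate_succ_apply']; exact peel_mono ih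

def WW (c : ℤ) (Q P VX VY : ℤ → ℤ) (τ : ℕ) : Set (ℤ × ℤ) :=
  {z | ∀ j, Lev c Q P VX VY j τ ≤ Q j * z.2 - P j * z.1}

theorem Lev_edge {c : ℤ} {Q P VX VY : ℤ → ℤ} (h : Chain c Q P VX VY) (j : ℤ) (τ : ℕ) :
    Lev c Q P VX VY (j+1) τ = Q (j+1) * zy c Q P VY j τ - P (j+1) * zx c Q VX j τ := by
  obtain ⟨l, -, -, h1, h2⟩ := edge h j τ
  unfold Lev
  rw [h1, h2]; ring

theorem slope_lt {c : ℤ} {Q P VX VY : ℤ → ℤ} (h : Chain c Q P VX VY) :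
    StrictMono (fun j : ℤ => (P j : ℝ) / Q j) := by
  apply strictMono_int_of_lt_succ
  intro j
  have h1 : (0:ℝ) < Q j := by exact_mod_cast h.pos j
  have h2 : (0:ℝ) < Q (j+1) := by exact_mod_cast h.pos (j+1)
  have h3 : (Q j : ℝ) * P (j+1) - P j * Q (j+1) = 1 := by exact_mod_cast h.det j
  rw [div_lt_div_iff₀ h1 h2]
  linarith

theorem cross_nonneg {c : ℤ} {Q P VX VY : ℤ → ℤ} (h : Chain c Q P VX VY) {i j : ℤ} (hij : i ≤ j) :
    0 ≤ Q i * P j - P i * Q j := by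
  have h1 : (0:ℝ) < Q i := by exact_mod_cast h.pos i
  have h2 : (0:ℝ) < Q j := by exact_mod_cast h.pos j
  have := (slope_lt h).monotone hij
  rw [div_le_div_iff₀ h1 h2] at this
  have : P i * Q j ≤ P j * Q i := by exact_mod_cast this
  linarith

theorem vert_mem {c : ℤ} {Q P VX VY : ℤ → ℤ} (h : Chain c Q P VX VY) (i : ℤ) (τ : ℕ) :
    (zx c Q VX i τ, zy c Q P VY i τ) ∈ WW c Q P VX VY τ := by
  intro j
  simp only
  rcases le_or_gt j i with hij | hij
  · induction i, hij using Int.leInduction with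
    | base => exact le_of_eq rfl
    | succ i hi ih =>
      obtain ⟨l, l0, -, h1, h2⟩ := edge h i τ
      have cr := cross_nonneg h (show j ≤ i + 1 by omega)
      rw [h1, h2]
      nlinarith
  · have hij' : i ≤ j - 1 := by omega
    induction i, hij' using Int.leInductionDown with
    | base =>
      have := Lev_edge h (j-1) τ
      rw [sub_add_cancel] at this
      exact this.le
    | pred i hi ih =>
      obtain ⟨l, l0, -, h1, h2⟩ := edge h (i-1) τ
      rw [sub_add_cancel] at h1 h2
      have cr := cross_nonneg h (show i ≤ j by omega)
      have := ih (by omega)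
      rw [h1, h2] at this
      nlinarith

theorem VX_step {c : ℤ} {Q P VX VY : ℤ → ℤ} (h : Chain c Q P VX VY) (j : ℤ) : VX j + 1 ≤ VX (j+1) := by
  rw [h.vx j]
  have h1 := h.pos (j+1)
  have h2 := h.le (j+1)
  have : 1 ≤ (2*c+1) / Q (j+1) := by rw [Int.le_ediv_iff_mul_le (by omega)]; omega
  nlinarith

theorem VX_ge {c : ℤ} {Q P VX VY : ℤ → ℤ} (h : Chain c Q P VX VY) {i j : ℤ} (hij : i ≤ j) :
    VX i + (j - i) ≤ VX j := by
  induction j, hij using Int.leInduction with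
  | base => simp
  | succ j hj ih => have := VX_step h j; omega

theorem exists_idx {c : ℤ} {Q P VX VY : ℤ → ℤ} (h : Chain c Q P VX VY) (τ : ℕ) (x : ℤ) :
    ∃ j, zx c Q VX j τ ≤ x ∧ x < zx c Q VX (j+1) τ := by
  have hb : ∃ b : ℤ, ∀ j, zx c Q VX j τ ≤ x → j ≤ b := by
    refine ⟨max 0 (x + c - VX 0), fun j hj => ?_⟩
    by_contra hlt
    push Not at hlt
    have := VX_ge h (show 0 ≤ j by omega)
    have := (dxi_range h j τ).1
    unfold zx at hj
    omega
  have hi : ∃ j, zx c Q VX j τ ≤ x := by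
    refine ⟨min 0 (x - c - VX 0), ?_⟩
    have := VX_ge h (show min 0 (x - c - VX 0) ≤ 0 by omega)
    have := (dxi_range h (min 0 (x - c - VX 0)) τ).2
    unfold zx
    omega
  obtain ⟨j, hj, hmax⟩ := Int.exists_greatest_of_bdd hb hi
  refine ⟨j, hj, ?_⟩
  by_contra hlt
  push Not at hlt
  have := hmax _ hlt
  omega

/-- the embedding of the integer lattice -/
noncomputable def EE (n : ℕ) (w1 w2 k : ℤ) (z : ℤ × ℤ) : ℝ × ℝ :=
  (((z.1 + w1 : ℤ) : ℝ) / n, ((z.2 + k * z.1 + w2 : ℤ) : ℝ) / n)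

theorem EE_inj {n : ℕ} (hn : 0 < n) (w1 w2 k : ℤ) : Function.Injective (EE n w1 w2 k) := by
  rintro ⟨a, b⟩ ⟨a', b'⟩ hh
  have hn' : (n : ℝ) ≠ 0 := by positivity
  unfold EE at hh
  rw [Prod.mk.injEq] at hh
  obtain ⟨h1, h2⟩ := hh
  rw [div_left_inj' hn'] at h1 h2
  have h1 : a + w1 = a' + w1 := by exact_mod_cast h1
  have h2 : b + k * a + w2 = b' + k * a' + w2 := by exact_mod_cast h2
  have e : a = a' := by omega
  subst e
  ext
  · rfl
  · simp only; omega

theorem vert_extreme {c : ℤ} {Q P VX VY : ℤ → ℤ} (h : Chain c Q P VX VY) {n : ℕ} (hn : 0 < n)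
    (w1 w2 k : ℤ) (j : ℤ) (τ : ℕ) :
    EE n w1 w2 k (zx c Q VX j τ, zy c Q P VY j τ) ∈
      Set.extremePoints ℝ (convexHull ℝ (EE n w1 w2 k '' WW c Q P VX VY τ)) := by
  have hn' : (0 : ℝ) < n := by positivity
  let q : ℤ := Q j + Q (j+1)
  let p : ℤ := P j + P (j+1)
  let L : ℝ × ℝ →ₗ[ℝ] ℝ := (q : ℝ) • LinearMap.snd ℝ ℝ ℝ - ((p : ℝ) + q * k) • LinearMap.fst ℝ ℝ ℝ
  have hL : ∀ u : ℝ × ℝ, L u = q * u.2 - (p + q * k) * u.1 := by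
    intro u
    simp [L]
  apply extreme_of_strict_min _ _ L
  · exact ⟨_, vert_mem h j τ, rfl⟩
  · rintro _ ⟨z, hz, rfl⟩ hne
    have a1 := hz j
    have a2 := hz (j+1)
    rw [Lev_edge h] at a2
    rw [Lev] at a1
    set X := zx c Q VX j τ
    set Y := zy c Q P VY j τ
    have hne' : z ≠ (X, Y) := fun hh => hne (by rw [hh])
    have hs : q * Y - p * X < q * z.2 - p * z.1 := by
      have hge : q * Y - p * X ≤ q * z.2 - p * z.1 := by simp only [q, p]; linarith
      rcases hge.lt_or_eq with hh | hh
      · exact hh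
      · exfalso
        apply hne'
        have e1 : Q j * (z.2 - Y) - P j * (z.1 - X) = 0 := by simp only [q, p] at hh; linarith
        have e2 : Q (j+1) * (z.2 - Y) - P (j+1) * (z.1 - X) = 0 := by
          simp only [q, p] at hh; linarith
        have d := h.det j
        have d1 : z.1 - X = 0 := by
          linear_combination (-(z.1 - X)) * d + Q (j+1) * e1 - Q j * e2
        have d2 : z.2 - Y = 0 := by
          linear_combination (-(z.2 - Y)) * d + P (j+1) * e1 - P j * e2
        ext
        · simp only; omega
        · simp only; omega
    rw [hL, hL]
    unfold EE
    simp only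
    have hs' : (q : ℝ) * Y - p * X < q * z.2 - p * z.1 := by exact_mod_cast hs
    have : 0 < ((q : ℝ) * z.2 - p * z.1 - (q * Y - p * X)) / n := div_pos (by linarith) hn'
    push_cast
    rw [← sub_pos]
    convert this using 1
    field_simp
    ring

theorem WW_anti {c : ℤ} {Q P VX VY : ℤ → ℤ} (h : Chain c Q P VX VY) (τ : ℕ) :
    WW c Q P VX VY (τ+1) ⊆ WW c Q P VX VY τ := by
  intro z hz j
  have := hz j
  classical
  rw [Lev_succ h] at this
  split_ifs at this <;> omega

theorem WW_up {c : ℤ} {Q P VX VY : ℤ → ℤ} (h : Chain c Q P VX VY) (τ : ℕ) (z : ℤ × ℤ)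
    (hz : z ∈ WW c Q P VX VY τ) (N : ℤ) (hN : 0 ≤ N) : (z.1, z.2 + N) ∈ WW c Q P VX VY τ := by
  intro j
  have := hz j
  have := h.pos j
  simp only
  nlinarith

theorem vert_not_mem {c : ℤ} {Q P VX VY : ℤ → ℤ} (h : Chain c Q P VX VY) (j : ℤ) (τ : ℕ) :
    (zx c Q VX j τ, zy c Q P VY j τ) ∉ WW c Q P VX VY (τ+1) := by
  intro hz
  classical
  rcases fire_or h j τ with hf | hf
  · have := hz j
    rw [Lev_succ h, if_pos hf, Lev] at this
    simp only at this
    omega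
  · have := hz (j+1)
    rw [Lev_succ h, if_pos hf, Lev_edge h] at this
    simp only at this
    omega

theorem peel_step {c : ℤ} {Q P VX VY : ℤ → ℤ} (h : Chain c Q P VX VY) {n : ℕ} (hn : 0 < n)
    (w1 w2 k : ℤ) (τ : ℕ) :
    peel (EE n w1 w2 k '' WW c Q P VX VY τ) = EE n w1 w2 k '' WW c Q P VX VY (τ+1) := by
  have hn' : (0 : ℝ) < n := by positivity
  apply Set.Subset.antisymm
  · rintro _ ⟨⟨z, hz, rfl⟩, hne⟩
    refine ⟨z, ?_, rfl⟩
    by_contra hnot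
    apply hne
    have : ∃ j, ¬ (Lev c Q P VX VY j (τ+1) ≤ Q j * z.2 - P j * z.1) := by
      by_contra hh
      push Not at hh
      exact hnot hh
    obtain ⟨j', hj'⟩ := this
    obtain ⟨j, rfl⟩ : ∃ j, j' = j + 1 := ⟨j' - 1, by ring⟩
    classical
    rw [Lev_succ h] at hj'
    have hz1 := hz (j+1)
    have hf : fire c Q (j+1) τ := by
      by_contra hh
      rw [if_neg hh] at hj'
      omega
    rw [if_pos hf] at hj'
    have heq : Lev c Q P VX VY (j+1) τ = Q (j+1) * z.2 - P (j+1) * z.1 := by omega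
    have hz0 := hz j
    have hz2 := hz (j+1+1)
    rw [Lev_edge h] at heq
    rw [Lev_edge h] at hz2
    rw [Lev] at hz0
    obtain ⟨l, l0, l1, e1, e2⟩ := edge h j τ
    have l1 := l1 hf
    rw [e1, e2] at hz2
    have d0 := h.det j
    have d1 := h.det (j+1)
    set X := zx c Q VX j τ with hX
    set Y := zy c Q P VY j τ with hY
    set i := Q j * (z.2 - Y) - P j * (z.1 - X) with hi
    have x1 : z.1 - X = i * Q (j+1) := by
      rw [hi]; linear_combination (-(z.1-X)) * d0 + Q j * heq
    have x2 : z.2 - Y = i * P (j+1) := by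
      rw [hi]; linear_combination (-(z.2-Y)) * d0 + P j * heq
    have i0 : 0 ≤ i := by rw [hi]; linarith
    have i1 : i ≤ l := by
      have z1 : z.1 = X + i * Q (j+1) := by linarith
      have z2 : z.2 = Y + i * P (j+1) := by linarith
      rw [z1, z2] at hz2
      have : (l - i) * (Q (j+1) * P (j+1+1) - P (j+1) * Q (j+1+1)) ≥ 0 := by linarith
      rw [d1] at this
      linarith
    have hcase : i = 0 ∨ (i = 1 ∧ l = 1) := by omega
    rcases hcase with hh | ⟨hh, hl⟩
    · have : z = (zx c Q VX j τ, zy c Q P VY j τ) := by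
        rw [hh] at x1 x2
        ext
        · simp only [← hX]; omega
        · simp only [← hY]; omega
      rw [this]
      exact vert_extreme h hn w1 w2 k j τ
    · have : z = (zx c Q VX (j+1) τ, zy c Q P VY (j+1) τ) := by
        rw [hh] at x1 x2
        rw [hl] at e1 e2
        ext
        · simp only; omega
        · simp only; omega
      rw [this]
      exact vert_extreme h hn w1 w2 k (j+1) τ
  · rintro _ ⟨z, hz, rfl⟩
    have hzτ := WW_anti h τ hz
    refine ⟨⟨z, hzτ, rfl⟩, ?_⟩
    obtain ⟨j, hj1, hj2⟩ := exists_idx h τ z.1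
    have nv : ∀ j, EE n w1 w2 k z ≠ EE n w1 w2 k (zx c Q VX j τ, zy c Q P VY j τ) := by
      intro j hh
      have := EE_inj hn w1 w2 k hh
      rw [this] at hz
      exact vert_not_mem h j τ hz
    obtain ⟨l, l0, -, e1, e2⟩ := edge h j τ
    have hz1 := hzτ (j+1)
    rw [Lev_edge h] at hz1
    refine not_extreme_aux (EE n w1 w2 k '' WW c Q P VX VY τ) _ (EE n w1 w2 k (zx c Q VX j τ, zy c Q P VY j τ))
      (EE n w1 w2 k (zx c Q VX (j+1) τ, zy c Q P VY (j+1) τ)) (1 / n) (by positivity)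
      ⟨_, vert_mem h j τ, rfl⟩ ⟨_, vert_mem h (j+1) τ, rfl⟩ ?_ ?_ ?_ ?_ (nv j) (nv (j+1)) ?_
    · refine ⟨_, WW_up h τ z hzτ 1 (by norm_num), ?_⟩
      unfold EE
      ext
      · rfl
      · simp only; push_cast; field_simp; ring
    · unfold EE; simp only
      rw [div_le_div_iff_of_pos_right hn']
      exact_mod_cast (by omega)
    · unfold EE; simp only
      rw [div_le_div_iff_of_pos_right hn']
      exact_mod_cast (by omega)
    · unfold EE; simp only
      rw [div_lt_div_iff_of_pos_right hn']
      exact_mod_cast (by omega)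
    · unfold EE; simp only
      rw [e1, e2]
      set X := zx c Q VX j τ
      set Y := zy c Q P VY j τ
      have : (0:ℤ) ≤ l * ((Q (j+1) * z.2 - P (j+1) * z.1) - (Q (j+1) * Y - P (j+1) * X)) :=
        mul_nonneg l0 (by linarith)
      have : (0:ℝ) ≤ l * ((Q (j+1) * z.2 - P (j+1) * z.1) - (Q (j+1) * Y - P (j+1) * X)) := by
        exact_mod_cast this
      have := div_nonneg this (sq_nonneg (n : ℝ))
      rw [← sub_nonneg]
      refine this.trans_eq ?_
      push_cast
      rw [div_sub_div_same, div_sub_div_same, div_sub_div_same, div_sub_div_same]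
      field_simp
      ring

theorem peel_iter {c : ℤ} {Q P VX VY : ℤ → ℤ} (h : Chain c Q P VX VY) {n : ℕ} (hn : 0 < n)
    (w1 w2 k : ℤ) (m : ℕ) :
    peel^[m] (EE n w1 w2 k '' WW c Q P VX VY 0) = EE n w1 w2 k '' WW c Q P VX VY m := by
  induction m with
  | zero => rfl
  | succ m ih => rw [Function.iterate_succ_apply', ih, peel_step h hn]

theorem WW_anti_le {c : ℤ} {Q P VX VY : ℤ → ℤ} (h : Chain c Q P VX VY) {a b : ℕ} (hab : a ≤ b) :
    WW c Q P VX VY b ⊆ WW c Q P VX VY a := by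
  exact antitone_nat_of_succ_le (f := WW c Q P VX VY) (fun n => WW_anti h n) hab

theorem WW_mul {c : ℤ} {Q P VX VY : ℤ → ℤ} (h : Chain c Q P VX VY) {t : ℕ}
    (ht : (t : ℤ) = 2 * c + 1) (k : ℕ) (z : ℤ × ℤ) :
    z ∈ WW c Q P VX VY (t * k) ↔ (z.1, z.2 - k) ∈ WW c Q P VX VY 0 := by
  unfold WW
  simp only [Set.mem_ofPred_eq]
  refine forall_congr' fun j => ?_
  unfold Lev zx zy
  rw [(dsp_mul h j t ht k).1, (dsp_mul h j t ht k).2]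
  simp only [dxi, deta]
  constructor <;> intro hh <;> nlinarith

theorem peel_lower {c : ℤ} {Q P VX VY : ℤ → ℤ} (h : Chain c Q P VX VY) {n : ℕ} (hn : 0 < n)
    (w1 w2 k : ℤ) {t : ℕ} (ht : (t : ℤ) = 2 * c + 1) (m r : ℕ) (hr : m ≤ t * r) (z : ℤ × ℤ)
    (hz : (z.1, z.2 - (r:ℤ)) ∈ WW c Q P VX VY 0) :
    EE n w1 w2 k z ∈ peel^[m] (EE n w1 w2 k '' WW c Q P VX VY 0) := by
  rw [peel_iter h hn]
  exact ⟨z, WW_anti_le h hr ((WW_mul h ht r z).2 hz), rfl⟩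

theorem peel_upper {c : ℤ} {Q P VX VY : ℤ → ℤ} (h : Chain c Q P VX VY) {n : ℕ} (hn : 0 < n)
    (w1 w2 k : ℤ) {t : ℕ} (ht : (t : ℤ) = 2 * c + 1) (m r : ℕ) (hr : t * r ≤ m) (z : ℤ × ℤ)
    (hz : EE n w1 w2 k z ∈ peel^[m] (EE n w1 w2 k '' WW c Q P VX VY 0)) :
    (z.1, z.2 - (r:ℤ)) ∈ WW c Q P VX VY 0 := by
  rw [peel_iter h hn] at hz
  obtain ⟨z', hz', he⟩ := hz
  rw [EE_inj hn w1 w2 k he] at hz'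
  exact (WW_mul h ht r z).1 (WW_anti_le h hr hz')

theorem coprime_count (q N : ℕ) (hq : 0 < q) :
    (((Finset.Ioc 0 N).filter (fun p => Nat.Coprime q p)).card : ℤ) =
      ∑ d ∈ q.divisors, ArithmeticFunction.moebius d * ((N / d : ℕ) : ℤ) := by
  have key : ∀ g : ℕ, 0 < g → (∑ d ∈ g.divisors, ArithmeticFunction.moebius d) = if g = 1 then 1 else 0 := by
    intro g hg
    rw [← ArithmeticFunction.coe_mul_zeta_apply, ArithmeticFunction.moebius_mul_coe_zeta,
      ArithmeticFunction.one_apply]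
  rw [Finset.card_filter]
  push_cast
  have : ∀ p ∈ Finset.Ioc 0 N, (if Nat.Coprime q p then (1:ℤ) else 0) =
      ∑ d ∈ q.divisors, if d ∣ p then ArithmeticFunction.moebius d else 0 := by
    intro p hp
    rw [Finset.mem_Ioc] at hp
    have e0 : (if Nat.Coprime q p then (1:ℤ) else 0) = if Nat.gcd q p = 1 then 1 else 0 := by
      simp only [Nat.coprime_iff_gcd_eq_one]
    rw [e0, ← key _ (Nat.gcd_pos_of_pos_left p hq), ← Finset.sum_filter]
    apply Finset.sum_congr _ (fun _ _ => rfl)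
    ext d
    simp [Nat.mem_divisors, Nat.dvd_gcd_iff]
    constructor
    · rintro ⟨⟨h1, h2⟩, h3⟩; exact ⟨⟨h1, by omega⟩, h2⟩
    · rintro ⟨⟨h1, h2⟩, h3⟩; exact ⟨⟨h1, h3⟩, by omega⟩
  rw [Finset.sum_congr rfl this, Finset.sum_comm]
  apply Finset.sum_congr rfl
  intro d _
  rw [← Finset.sum_filter, Finset.sum_const, Nat.Ioc_filter_dvd_card_eq_div, nsmul_eq_mul, mul_comm]
  push_cast; rfl

theorem totient_moebius (q : ℕ) (hq : 0 < q) :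
    (Nat.totient q : ℤ) = ∑ d ∈ q.divisors, ArithmeticFunction.moebius d * ((q / d : ℕ) : ℤ) := by
  rw [← coprime_count q q hq]
  congr 1
  have h2 := Nat.filter_coprime_Ico_eq_totient q 1
  rw [add_comm] at h2
  exact h2.symm

/-- number of reduced fractions with denominator q in (0, σ] is close to σ φ(q) -/
theorem coprime_count_approx (q : ℕ) (hq : 0 < q) (σ : ℝ) (hσ : 0 ≤ σ) :
    |(((Finset.Ioc 0 ⌊σ * q⌋₊).filter (fun p => Nat.Coprime q p)).card : ℝ) - σ * Nat.totient q| ≤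
      (q.divisors.card : ℝ) := by
  have h1 : (((Finset.Ioc 0 ⌊σ * q⌋₊).filter (fun p => Nat.Coprime q p)).card : ℝ) =
    ∑ d ∈ q.divisors, (ArithmeticFunction.moebius d : ℝ) * ((⌊σ * q⌋₊ / d : ℕ) : ℝ) := by
    rw [← Int.cast_natCast, coprime_count q ⌊σ * q⌋₊ hq, Int.cast_sum]
    apply Finset.sum_congr rfl
    intro d _
    rw [Int.cast_mul, Int.cast_natCast]
  have h2 : (Nat.totient q : ℝ) = ∑ d ∈ q.divisors, (ArithmeticFunction.moebius d : ℝ) * ((q / d : ℕ) : ℝ) := by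
    rw [← Int.cast_natCast, totient_moebius q hq, Int.cast_sum]
    apply Finset.sum_congr rfl
    intro d _
    rw [Int.cast_mul, Int.cast_natCast]
  rw [h1, h2, Finset.mul_sum, ← Finset.sum_sub_distrib, Finset.card_eq_sum_ones]
  push_cast
  refine (Finset.abs_sum_le_sum_abs _ _).trans (Finset.sum_le_sum fun d hd => ?_)
  rw [Nat.mem_divisors] at hd
  have hd0 : 0 < d := Nat.pos_of_dvd_of_pos hd.1 hq
  have hd0' : (0:ℝ) < d := by exact_mod_cast hd0
  rw [← Nat.floor_div_natCast, Nat.cast_div hd.1 hd0'.ne']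
  have e : (ArithmeticFunction.moebius d : ℝ) * (⌊σ * q / d⌋₊ : ℝ) - σ * ((ArithmeticFunction.moebius d : ℝ) * ((q:ℝ) / d))
     = (ArithmeticFunction.moebius d : ℝ) * ((⌊σ * q / d⌋₊ : ℝ) - σ * q / d) := by ring
  rw [e, abs_mul]
  have m1 : |(ArithmeticFunction.moebius d : ℝ)| ≤ 1 := by
    exact_mod_cast (ArithmeticFunction.abs_moebius_le_one (n := d))
  have hnn : 0 ≤ σ * q / d := by positivity
  have m2 : |(⌊σ * q / d⌋₊ : ℝ) - σ * q / d| ≤ 1 := by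
    rw [abs_le]
    constructor
    · linarith [Nat.lt_floor_add_one (σ * q / d)]
    · linarith [Nat.floor_le hnn]
  exact mul_le_one₀ m1 (abs_nonneg _) m2

noncomputable def HH (t : ℕ) : ℝ := ∑ q ∈ Finset.Ioc 0 t, (q : ℝ) * ((t / q : ℕ) : ℝ) * Nat.totient q

noncomputable def om (t : ℕ) : ℝ := (t : ℝ) ^ 2 * (1 + Real.log t)

theorem sum_inv_le (t : ℕ) : ∑ d ∈ Finset.Ioc 0 t, (1 : ℝ) / d ≤ 1 + Real.log t := by
  have := harmonic_le_one_add_log t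
  rw [harmonic_eq_sum_Icc] at this
  push_cast at this
  refine le_trans (le_of_eq ?_) this
  apply Finset.sum_congr rfl
  intro d _
  rw [one_div]

theorem sum_divisors_le (t : ℕ) : ∑ q ∈ Finset.Ioc 0 t, (q.divisors.card : ℝ) ≤ t * (1 + Real.log t) := by
  have h1 := ArithmeticFunction.sum_Ioc_sigma0_eq_sum_div t
  have h2 : ∑ q ∈ Finset.Ioc 0 t, (q.divisors.card : ℝ) = ∑ q ∈ Finset.Ioc 0 t, ((t / q : ℕ) : ℝ) := by
    rw [← Nat.cast_sum, ← Nat.cast_sum, ← h1]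
    congr 1
    apply Finset.sum_congr rfl
    intro q _
    rw [ArithmeticFunction.sigma_zero_apply]
  rw [h2]
  calc _ ≤ ∑ q ∈ Finset.Ioc 0 t, (t : ℝ) * (1 / q) := by
        apply Finset.sum_le_sum
        intro q _
        rw [mul_one_div]
        exact Nat.cast_div_le
    _ ≤ _ := by
        rw [← Finset.mul_sum]
        exact mul_le_mul_of_nonneg_left (sum_inv_le t) (by positivity)

/-- the weighted Farey count is close to linear -/
theorem farey_count (t : ℕ) (σ : ℝ) (hσ : 0 ≤ σ) :
    |∑ q ∈ Finset.Ioc 0 t, (q : ℝ) * ((t / q : ℕ) : ℝ) *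
       (((Finset.Ioc 0 ⌊σ * q⌋₊).filter (fun p => Nat.Coprime q p)).card : ℝ) - σ * HH t| ≤ om t := by
  unfold HH om
  rw [Finset.mul_sum, ← Finset.sum_sub_distrib]
  refine (Finset.abs_sum_le_sum_abs _ _).trans ?_
  calc _ ≤ ∑ q ∈ Finset.Ioc 0 t, (t : ℝ) * (q.divisors.card : ℝ) := by
        apply Finset.sum_le_sum
        intro q hq
        rw [Finset.mem_Ioc] at hq
        have := coprime_count_approx q hq.1 σ hσ
        rw [show ∀ a b c d : ℝ, a * b * c - d * (a * b * ((Nat.totient q : ℕ) : ℝ)) =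
          (a * b) * (c - d * ((Nat.totient q : ℕ) : ℝ)) by intros; ring, abs_mul]
        have h1 : |(q : ℝ) * ((t / q : ℕ) : ℝ)| ≤ t := by
          rw [abs_of_nonneg (by positivity)]
          exact_mod_cast Nat.mul_div_le t q
        exact mul_le_mul h1 this (abs_nonneg _) (by positivity)
    _ ≤ _ := by
        rw [← Finset.mul_sum, sq, mul_assoc]
        exact mul_le_mul_of_nonneg_left (sum_divisors_le t) (by positivity)

open ArithmeticFunction in
theorem HH_eq (t : ℕ) : HH t = ∑ d ∈ Finset.Ioc 0 t, ∑ m ∈ Finset.Ioc 0 t,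
    (moebius d : ℝ) * d * ∑ e ∈ Finset.Ioc 0 (t / d / m), (e : ℝ) ^ 2 := by
  let f : ArithmeticFunction ℝ := ⟨fun d => (moebius d : ℝ) * d, by simp⟩
  let g : ArithmeticFunction ℝ := ⟨fun d => (d : ℝ) ^ 2, by simp⟩
  have hf : ∀ d, f d = (moebius d : ℝ) * d := fun d => rfl
  have hg : ∀ d, g d = (d : ℝ) ^ 2 := fun d => rfl
  have hfg : ∀ q, 0 < q → (f * g) q = q * Nat.totient q := by
    intro q hq
    have h2 : (Nat.totient q : ℝ) = ∑ d ∈ q.divisors, (moebius d : ℝ) * ((q / d : ℕ) : ℝ) := by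
      rw [← Int.cast_natCast, totient_moebius q hq, Int.cast_sum]
      apply Finset.sum_congr rfl
      intro d _
      rw [Int.cast_mul, Int.cast_natCast]
    rw [h2, mul_apply, Finset.mul_sum,
      Nat.sum_divisorsAntidiagonal (f := fun a b => f a * g b) (n := q)]
    apply Finset.sum_congr rfl
    intro d hd
    rw [Nat.mem_divisors] at hd
    have hd0 : 0 < d := Nat.pos_of_dvd_of_pos hd.1 hq
    have hd0' : (d:ℝ) ≠ 0 := by positivity
    rw [hf, hg, Nat.cast_div hd.1 hd0']
    field_simp
  have h1 : HH t = ∑ n ∈ Finset.Ioc 0 t, (f * g * ((zeta : ArithmeticFunction ℕ) : ArithmeticFunction ℝ)) n := by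
    rw [sum_Ioc_mul_zeta_eq_sum]
    unfold HH
    apply Finset.sum_congr rfl
    intro q hq
    rw [Finset.mem_Ioc] at hq
    rw [hfg q hq.1]
    ring
  rw [h1, mul_assoc, mul_comm g, sum_Ioc_mul_eq_sum_sum]
  apply Finset.sum_congr rfl
  intro d hd
  rw [sum_Ioc_mul_eq_sum_sum, ← Finset.mul_sum, hf]
  congr 1
  have : ∀ m ∈ Finset.Ioc 0 (t / d), ((zeta : ArithmeticFunction ℕ) : ArithmeticFunction ℝ) m *
      ∑ e ∈ Finset.Ioc 0 (t / d / m), g e = ∑ e ∈ Finset.Ioc 0 (t / d / m), (e : ℝ) ^ 2 := by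
    intro m hm
    rw [Finset.mem_Ioc] at hm
    rw [natCoe_apply, zeta_apply, if_neg (by omega)]
    simp [hg]
  rw [Finset.sum_congr rfl this]
  apply Finset.sum_subset
  · apply Finset.Ioc_subset_Ioc_right
    exact Nat.div_le_self t d
  · intro m hm hm2
    rw [Finset.mem_Ioc] at hm hm2
    have : t / d / m = 0 := Nat.div_eq_of_lt (by omega)
    rw [this]; simp

theorem sum_sq_formula (N : ℕ) : ∑ e ∈ Finset.Ioc 0 N, (e : ℝ) ^ 2 = (N:ℝ)^3/3 + (N:ℝ)^2/2 + N/6 := by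
  induction N with
  | zero => simp
  | succ N ih => rw [Finset.sum_Ioc_succ_top (by omega), ih]; push_cast; ring

theorem sum_sq_approx (t k : ℕ) (hk : 0 < k) :
    |∑ e ∈ Finset.Ioc 0 (t / k), (e : ℝ) ^ 2 - ((t : ℝ) / k) ^ 3 / 3| ≤ ((t : ℝ) / k) ^ 2 := by
  rw [sum_sq_formula]
  have h1 : ((t / k : ℕ) : ℝ) ≤ (t : ℝ) / k := Nat.cast_div_le
  have h2 : (t : ℝ) / k < ((t / k : ℕ) : ℝ) + 1 := by
    rw [div_lt_iff₀ (by exact_mod_cast hk)]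
    have := Nat.lt_mul_div_succ t hk
    rw [mul_comm]
    exact_mod_cast this
  have h3 : ((t / k : ℕ) : ℝ) ≤ ((t / k : ℕ) : ℝ) ^ 2 := by
    exact_mod_cast Nat.le_self_pow (by norm_num) _
  have h0 : (0:ℝ) ≤ ((t / k : ℕ) : ℝ) := by positivity
  generalize ((t / k : ℕ) : ℝ) = N at *
  generalize (t : ℝ) / k = y at *
  have hN2 : N ^ 2 ≤ y ^ 2 := by gcongr
  have hN3 : N ^ 3 ≤ y ^ 3 := by gcongr
  rw [abs_le]
  constructor
  · have : y ^ 3 - N ^ 3 ≤ 3 * y ^ 2 := by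
      have : y^3 - N^3 = (y - N) * (y^2 + y * N + N^2) := by ring
      rw [this]
      have : y ^ 2 + y * N + N ^ 2 ≤ 3 * y ^ 2 := by nlinarith
      have h5 : 0 ≤ y ^ 2 + y * N + N ^ 2 := by nlinarith
      nlinarith
    nlinarith
  · nlinarith

theorem sum_inv_sq_tail (t N : ℕ) (ht : 0 < t) (hN : t ≤ N) :
    ∑ d ∈ Finset.Ioc t N, (1 : ℝ) / d ^ 2 ≤ 1 / t := by
  have := sum_Ioc_inv_sq_le_sub (α := ℝ) (k := t) (n := N) (by omega) hN
  have h2 : (0:ℝ) ≤ (N:ℝ)⁻¹ := by positivity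
  simp only [one_div]
  linarith

theorem sum_inv_sq_le (N : ℕ) : ∑ d ∈ Finset.Ioc 0 N, (1 : ℝ) / d ^ 2 ≤ 2 := by
  rcases Nat.eq_zero_or_pos N with h | h
  · subst h; simp
  · rw [← Finset.sum_Ioc_consecutive _ (Nat.zero_le 1) h]
    have := sum_inv_sq_tail 1 N one_pos h
    simp at *
    linarith

theorem partial_approx (f : ℕ → ℝ) (hf : ∀ d, 0 < d → |f d| ≤ 1 / (d:ℝ)^2) (S : ℝ)
    (hS : Filter.Tendsto (fun N => ∑ d ∈ Finset.Ioc 0 N, f d) Filter.atTop (nhds S)) (t : ℕ) (ht : 0 < t) :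
    |∑ d ∈ Finset.Ioc 0 t, f d - S| ≤ 1 / t := by
  rw [abs_sub_comm]
  have h1 : Filter.Tendsto (fun N => |∑ d ∈ Finset.Ioc 0 N, f d - ∑ d ∈ Finset.Ioc 0 t, f d|) Filter.atTop
      (nhds |S - ∑ d ∈ Finset.Ioc 0 t, f d|) := (hS.sub_const _).abs
  apply le_of_tendsto h1
  filter_upwards [Filter.eventually_ge_atTop t] with N hN
  rw [← Finset.sum_Ioc_consecutive f (Nat.zero_le t) hN, add_sub_cancel_left]
  refine (Finset.abs_sum_le_sum_abs _ _).trans (le_trans ?_ (sum_inv_sq_tail t N ht hN))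
  apply Finset.sum_le_sum
  intro d hd
  rw [Finset.mem_Ioc] at hd
  exact hf d (by omega)

theorem Ioc_sum_range (f : ℕ → ℝ) (N : ℕ) : ∑ d ∈ Finset.Ioc 0 N, f d = ∑ d ∈ Finset.range N, f (d+1) := by
  induction N with
  | zero => simp
  | succ N ih => rw [Finset.sum_Ioc_succ_top (by omega), ih, Finset.sum_range_succ]

theorem zeta3_summable : Summable (fun n : ℕ => 1 / ((n : ℝ) + 1) ^ 3) := by
  have h : Summable (fun n : ℕ => 1 / (n : ℝ) ^ 3) := Real.summable_one_div_nat_pow.2 (by norm_num)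
  have := (summable_nat_add_iff 1).2 h
  simpa using this

theorem zeta3_ge : 1 ≤ zeta3 := by
  have := zeta3_summable.le_tsum 0 (fun j _ => by positivity)
  simpa [zeta3] using this

theorem zeta3_partial (t : ℕ) (ht : 0 < t) : |∑ d ∈ Finset.Ioc 0 t, 1 / (d:ℝ)^3 - zeta3| ≤ 1 / t := by
  apply partial_approx _ _ _ _ t ht
  · intro d hd
    have hd' : (1:ℝ) ≤ d := by exact_mod_cast hd
    rw [abs_of_nonneg (by positivity)]
    apply one_div_le_one_div_of_le (by positivity)
    exact pow_le_pow_right₀ hd' (by norm_num)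
  · have := zeta3_summable.hasSum.tendsto_sum_nat
    refine this.congr fun N => ?_
    rw [Ioc_sum_range]
    push_cast
    rfl

open ArithmeticFunction in
theorem moebius_hasSum : HasSum (fun n : ℕ => (moebius n : ℝ) / (n:ℝ)^2) (6 / Real.pi ^ 2) := by
  have hs : (1:ℝ) < (2:ℂ).re := by norm_num
  have h1 := LSeries_zeta_mul_Lseries_moebius hs
  rw [LSeries_zeta_eq_riemannZeta hs, riemannZeta_two] at h1
  have h2 := (LSeriesSummable_moebius_iff.2 hs).LSeriesHasSum
  have h3 : LSeries (fun n => ((moebius n : ℤ) : ℂ)) 2 = ((6 / Real.pi ^ 2 : ℝ) : ℂ) := by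
    have hpi : (Real.pi : ℂ) ≠ 0 := by exact_mod_cast Real.pi_ne_zero
    push_cast
    field_simp
    field_simp at h1
    rw [mul_comm] at h1
    linear_combination h1
  rw [h3] at h2
  unfold LSeriesHasSum at h2
  rw [← Complex.hasSum_ofReal]
  convert h2 using 2 with n
  rcases Nat.eq_zero_or_pos n with h | h
  · subst h; simp
  · rw [LSeries.term_of_ne_zero (by omega)]
    push_cast
    congr 1
    exact_mod_cast (Complex.cpow_natCast (n : ℂ) 2).symm

open ArithmeticFunction in
theorem moebius_partial (t : ℕ) (ht : 0 < t) :
    |∑ d ∈ Finset.Ioc 0 t, (moebius d : ℝ) / (d:ℝ)^2 - 6 / Real.pi^2| ≤ 1 / (t:ℝ) := by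
  apply partial_approx _ _ _ _ t ht
  · intro d hd
    rw [abs_div, abs_of_nonneg (show (0:ℝ) ≤ (d:ℝ)^2 by positivity)]
    have m1 : |(moebius d : ℝ)| ≤ 1 := by
      exact_mod_cast (abs_moebius_le_one (n := d))
    gcongr
  · have h := moebius_hasSum
    have h0 := (hasSum_nat_add_iff' 1).2 h
    simp at h0
    have := h0.tendsto_sum_nat
    refine this.congr fun N => ?_
    rw [Ioc_sum_range]
    push_cast
    rfl

noncomputable def AA : ℝ := 2 * zeta3 / Real.pi ^ 2

theorem AA_pos : 0 < AA := by
  have := zeta3_ge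
  unfold AA; positivity

theorem om_ge (t : ℕ) (_ : 0 < t) : (t:ℝ)^2 ≤ om t := by
  unfold om
  have : 0 ≤ Real.log t := Real.log_natCast_nonneg t
  nlinarith [sq_nonneg (t:ℝ)]

open ArithmeticFunction in
theorem HH_approx : ∃ C : ℝ, 0 < C ∧ ∀ t : ℕ, 0 < t → |HH t - AA * (t:ℝ)^3| ≤ C * om t := by
  refine ⟨3 + zeta3, by linarith [zeta3_ge], fun t ht => ?_⟩
  have ht' : (0:ℝ) < t := by exact_mod_cast ht
  set M := ∑ d ∈ Finset.Ioc 0 t, (moebius d : ℝ) / (d:ℝ)^2 with hM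
  set Z := ∑ d ∈ Finset.Ioc 0 t, 1 / (d:ℝ)^3 with hZ
  have e1 : |HH t - (t:ℝ)^3 / 3 * (M * Z)| ≤ 2 * om t := by
    have : (t:ℝ)^3 / 3 * (M * Z) = ∑ d ∈ Finset.Ioc 0 t, ∑ m ∈ Finset.Ioc 0 t,
        (moebius d : ℝ) * d * (((t:ℝ) / ((d * m : ℕ) : ℝ))^3 / 3) := by
      rw [hM, hZ, Finset.sum_mul_sum, Finset.mul_sum]
      apply Finset.sum_congr rfl
      intro d hd
      rw [Finset.mul_sum]
      apply Finset.sum_congr rfl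
      intro m hm
      rw [Finset.mem_Ioc] at hd hm
      have h1 : (d:ℝ) ≠ 0 := by have := hd.1; positivity
      have h2 : (m:ℝ) ≠ 0 := by have := hm.1; positivity
      push_cast
      field_simp
    rw [this, HH_eq, ← Finset.sum_sub_distrib]
    simp_rw [← Finset.sum_sub_distrib, ← mul_sub]
    calc _ ≤ ∑ d ∈ Finset.Ioc 0 t, ∑ m ∈ Finset.Ioc 0 t, (t:ℝ)^2 * ((1 / (d:ℝ)) * (1 / (m:ℝ)^2)) := by
          refine (Finset.abs_sum_le_sum_abs _ _).trans (Finset.sum_le_sum fun d hd => ?_)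
          refine (Finset.abs_sum_le_sum_abs _ _).trans (Finset.sum_le_sum fun m hm => ?_)
          rw [Finset.mem_Ioc] at hd hm
          have h1 : (0:ℝ) < d := by exact_mod_cast hd.1
          have h2 : (0:ℝ) < m := by exact_mod_cast hm.1
          rw [Nat.div_div_eq_div_mul, abs_mul, abs_mul, abs_of_pos h1]
          have a1 := sum_sq_approx t (d * m) (Nat.mul_pos hd.1 hm.1)
          have m1 : |(moebius d : ℝ)| ≤ 1 := by
            exact_mod_cast (abs_moebius_le_one (n := d))
          have m2 : |(moebius d : ℝ)| * d ≤ d := by nlinarith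
          refine (mul_le_mul m2 a1 (abs_nonneg _) h1.le).trans (le_of_eq ?_)
          push_cast
          field_simp
      _ = (t:ℝ)^2 * ((∑ d ∈ Finset.Ioc 0 t, 1 / (d:ℝ)) * (∑ m ∈ Finset.Ioc 0 t, 1 / (m:ℝ)^2)) := by
          rw [Finset.sum_mul_sum, Finset.mul_sum]
          simp_rw [Finset.mul_sum]
      _ ≤ (t:ℝ)^2 * ((1 + Real.log t) * 2) := by
          have l0 : 0 ≤ Real.log t := Real.log_natCast_nonneg t
          apply mul_le_mul_of_nonneg_left _ (by positivity)
          exact mul_le_mul (sum_inv_le t) (sum_inv_sq_le t) (Finset.sum_nonneg fun _ _ => by positivity) (by positivity)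
      _ = _ := by unfold om; ring
  have hMb := moebius_partial t ht
  have hZb := zeta3_partial t ht
  rw [← hM] at hMb
  rw [← hZ] at hZb
  have z1 := zeta3_ge
  have hM2 : |M| ≤ 2 := by
    refine (Finset.abs_sum_le_sum_abs _ _).trans (le_trans ?_ (sum_inv_sq_le t))
    apply Finset.sum_le_sum
    intro d hd
    rw [abs_div, abs_of_nonneg (show (0:ℝ) ≤ (d:ℝ)^2 by positivity)]
    have m1 : |(moebius d : ℝ)| ≤ 1 := by
      exact_mod_cast (abs_moebius_le_one (n := d))
    gcongr
  have e2 : |M * Z - 6 / Real.pi^2 * zeta3| ≤ (2 + zeta3) / t := by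
    have : M * Z - 6 / Real.pi^2 * zeta3 = M * (Z - zeta3) + (M - 6 / Real.pi^2) * zeta3 := by ring
    rw [this]
    refine (abs_add_le _ _).trans ?_
    rw [abs_mul, abs_mul, abs_of_pos (show 0 < zeta3 by linarith), add_div]
    apply add_le_add
    · calc _ ≤ 2 * (1 / (t:ℝ)) := mul_le_mul hM2 hZb (abs_nonneg _) (by norm_num)
        _ = _ := by ring
    · calc _ ≤ (1 / (t:ℝ)) * zeta3 := mul_le_mul_of_nonneg_right hMb (by linarith)
        _ = _ := by ring
  have e3 : |(t:ℝ)^3 / 3 * (M * Z) - AA * (t:ℝ)^3| ≤ (2 + zeta3) / 3 * (t:ℝ)^2 := by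
    have : (t:ℝ)^3 / 3 * (M * Z) - AA * (t:ℝ)^3 = (t:ℝ)^3/3 * (M * Z - 6 / Real.pi^2 * zeta3) := by
      unfold AA; ring
    rw [this, abs_mul, abs_of_pos (show 0 < (t:ℝ)^3/3 by positivity)]
    calc _ ≤ (t:ℝ)^3/3 * ((2 + zeta3) / t) := mul_le_mul_of_nonneg_left e2 (by positivity)
      _ = _ := by field_simp
  have e4 := om_ge t ht
  have e5 : |HH t - AA * (t:ℝ)^3| ≤ 2 * om t + (2 + zeta3) / 3 * (t:ℝ)^2 := by
    have := abs_sub_le (HH t) ((t:ℝ)^3 / 3 * (M * Z)) (AA * (t:ℝ)^3)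
    linarith
  have : (2 + zeta3) / 3 * (t:ℝ)^2 ≤ (1 + zeta3) * om t := by
    have h0 : (0:ℝ) ≤ (t:ℝ)^2 := by positivity
    exact mul_le_mul (by linarith) e4 h0 (by linarith)
  linarith

theorem P_nonneg {c : ℤ} {Q P VX VY : ℤ → ℤ} (h : Chain c Q P VX VY) (hQ0 : Q 0 = 1) (hP0 : P 0 = 0)
    (k : ℕ) : 0 ≤ P k := by
  have := cross_nonneg h (show (0:ℤ) ≤ k by positivity)
  rw [hQ0, hP0] at this
  linarith

theorem next_unique {c : ℤ} {Q P VX VY : ℤ → ℤ} (h : Chain c Q P VX VY) (j : ℤ) (q p : ℤ)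
    (hq : q ≤ 2 * c + 1) (hcop : IsCoprime q p) (h1 : P j * q < p * Q j)
    (h2 : p * Q (j+1) ≤ P (j+1) * q) : q = Q (j+1) ∧ p = P (j+1) := by
  have d := h.det j
  have s := h.sum j
  have p0 := h.pos j
  have p1 := h.pos (j+1)
  obtain ⟨α, hα⟩ : ∃ α, α = p * Q j - P j * q := ⟨_, rfl⟩
  obtain ⟨β, hβ⟩ : ∃ β, β = P (j+1) * q - p * Q (j+1) := ⟨_, rfl⟩
  have e1 : q = α * Q (j+1) + β * Q j := by rw [hα, hβ]; linear_combination -q * d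
  have e2 : p = α * P (j+1) + β * P j := by rw [hα, hβ]; linear_combination -p * d
  have a1 : 1 ≤ α := by omega
  have b0 : β = 0 := by
    by_contra hh
    have : 1 ≤ β := by omega
    nlinarith
  subst b0
  rw [zero_mul, add_zero] at e1 e2
  have : α = 1 := by
    have hu : IsUnit α := hcop.isUnit_of_dvd' ⟨_, e1⟩ ⟨_, e2⟩
    rcases Int.isUnit_iff.1 hu with h | h <;> omega
  subst this
  simpa using And.intro e1 e2

open Classical in
theorem VX_eq {c : ℤ} {Q P VX VY : ℤ → ℤ} (h : Chain c Q P VX VY) (hQ0 : Q 0 = 1) (hP0 : P 0 = 0)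
    (hV : VX 0 = 0) (t : ℕ) (ht : (t : ℤ) = 2 * c + 1) (k : ℕ) :
    VX k = ∑ q ∈ Finset.Ioc 0 t, ((q * (t / q) *
      ((Finset.Ioc 0 ⌊((P k : ℝ) / Q k) * q⌋₊).filter (fun p => Nat.Coprime q p)).card : ℕ) : ℤ) := by
  have mem : ∀ (k q p : ℕ), (p ∈ (Finset.Ioc 0 ⌊((P k : ℝ) / Q k) * q⌋₊).filter (fun p => Nat.Coprime q p)) ↔
      (0 < p ∧ (p:ℤ) * Q k ≤ P k * q ∧ Nat.Coprime q p) := by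
    intro k q p
    have hq : (0:ℝ) < Q k := by exact_mod_cast h.pos k
    have hp : (0:ℝ) ≤ P k := by exact_mod_cast P_nonneg h hQ0 hP0 k
    rw [Finset.mem_filter, Finset.mem_Ioc, Nat.le_floor_iff (by positivity), and_assoc]
    have : ((p:ℝ) ≤ (P k : ℝ) / Q k * q) ↔ (p:ℤ) * Q k ≤ P k * q := by
      rw [div_mul_eq_mul_div, le_div_iff₀ hq]
      exact_mod_cast Iff.rfl
    rw [this]
  induction k with
  | zero =>
    rw [Nat.cast_zero, hV]
    symm
    apply Finset.sum_eq_zero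
    intro q _
    rw [hP0]
    simp
  | succ k ih =>
    have p1 := h.pos (k+1)
    have l1 := h.le (k+1)
    have hcop : IsCoprime (Q (k+1)) (P (k+1)) := ⟨- P k, Q k, by linear_combination h.det k⟩
    have pk := P_nonneg h hQ0 hP0 k
    have pk1 := P_nonneg h hQ0 hP0 (k+1)
    have mono := cross_nonneg h (show (k:ℤ) ≤ k + 1 by omega)
    have d := h.det k
    have q0 := h.pos k
    have stp : ∀ q ∈ Finset.Ioc 0 t,
        ((Finset.Ioc 0 ⌊((P (k+1:ℕ) : ℝ) / Q (k+1:ℕ)) * q⌋₊).filter (fun p => Nat.Coprime q p)).card =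
        ((Finset.Ioc 0 ⌊((P k : ℝ) / Q k) * q⌋₊).filter (fun p => Nat.Coprime q p)).card +
          if q = (Q (k+1)).toNat then 1 else 0 := by
      intro q hq
      rw [Finset.mem_Ioc] at hq
      split_ifs with hqq
      · have hins : (Finset.Ioc 0 ⌊((P (k+1:ℕ) : ℝ) / Q (k+1:ℕ)) * q⌋₊).filter (fun p => Nat.Coprime q p) =
            insert (P (k+1)).toNat ((Finset.Ioc 0 ⌊((P k : ℝ) / Q k) * q⌋₊).filter (fun p => Nat.Coprime q p)) := by
          ext p
          rw [Finset.mem_insert, mem, mem]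
          push_cast at *
          constructor
          · rintro ⟨a1, a2, a3⟩
            by_cases hc : (p:ℤ) * Q k ≤ P k * q
            · right; exact ⟨a1, hc, a3⟩
            · left
              have := (next_unique h k q p (by omega) (Nat.isCoprime_iff_coprime.2 a3) (by omega) a2).2
              omega
          · rintro (a | ⟨a1, a2, a3⟩)
            · have ep : (p:ℤ) = P (k+1) := by omega
              have eq : (q:ℤ) = Q (k+1) := by omega
              refine ⟨?_, ?_, ?_⟩
              · have : (0:ℤ) < p := by
                  rw [ep]; by_contra hh
                  have : P (k+1) = 0 := by omega
                  rw [this] at d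
                  nlinarith
                exact_mod_cast this
              · rw [ep, eq]
              · rw [← Nat.isCoprime_iff_coprime, ep, eq]; exact hcop
            · refine ⟨a1, ?_, a3⟩
              have b1 : (p:ℤ) * Q k * Q (k+1) ≤ P k * q * Q (k+1) :=
                mul_le_mul_of_nonneg_right a2 (by omega)
              have b2 : 0 ≤ (Q k * P (k+1) - P k * Q (k+1)) * q := mul_nonneg mono (by positivity)
              have : Q k * ((p:ℤ) * Q (k+1)) ≤ Q k * (P (k+1) * q) := by linarith
              exact le_of_mul_le_mul_left this (by omega)
        rw [hins, Finset.card_insert_of_notMem]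
        rw [mem]
        rintro ⟨a1, a2, a3⟩
        have ep : (((P (k+1)).toNat : ℕ):ℤ) = P (k+1) := by push_cast at pk1; omega
        have eq : (q:ℤ) = Q (k+1) := by omega
        rw [ep, eq] at a2
        linarith
      · rw [add_zero]
        congr 1
        ext p
        rw [mem, mem]
        push_cast at *
        constructor
        · rintro ⟨a1, a2, a3⟩
          refine ⟨a1, ?_, a3⟩
          by_contra hc
          have := (next_unique h k q p (by omega) (Nat.isCoprime_iff_coprime.2 a3) (by omega) a2).1
          omega
        · rintro ⟨a1, a2, a3⟩
          refine ⟨a1, ?_, a3⟩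
          have b1 : (p:ℤ) * Q k * Q (k+1) ≤ P k * q * Q (k+1) :=
            mul_le_mul_of_nonneg_right a2 (by omega)
          have b2 : 0 ≤ (Q k * P (k+1) - P k * Q (k+1)) * q := mul_nonneg mono (by positivity)
          have : Q k * ((p:ℤ) * Q (k+1)) ≤ Q k * (P (k+1) * q) := by linarith
          exact le_of_mul_le_mul_left this (by omega)
    have e : (((k+1 : ℕ)) : ℤ) = (k:ℤ) + 1 := by push_cast; rfl
    rw [show VX ((k+1:ℕ):ℤ) = VX (k+1) by rw [e], h.vx k, ih]
    have : ∀ q ∈ Finset.Ioc 0 t, ((q * (t / q) *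
      ((Finset.Ioc 0 ⌊((P (k+1:ℕ) : ℝ) / Q (k+1:ℕ)) * q⌋₊).filter (fun p => Nat.Coprime q p)).card : ℕ) : ℤ) =
      ((q * (t / q) * ((Finset.Ioc 0 ⌊((P k : ℝ) / Q k) * q⌋₊).filter (fun p => Nat.Coprime q p)).card : ℕ) : ℤ) +
      (if q = (Q (k+1)).toNat then ((q * (t / q) : ℕ) : ℤ) else 0) := by
      intro q hq
      rw [stp q hq]
      split_ifs
      · push_cast; ring
      · push_cast; ring
    rw [Finset.sum_congr rfl this, Finset.sum_add_distrib, Finset.sum_ite_eq', if_pos]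
    · push_cast
      have eq : (((Q (k+1)).toNat : ℕ) : ℤ) = Q (k+1) := by omega
      rw [Int.toNat_of_nonneg (by omega), ht]
      ring
    · rw [Finset.mem_Ioc]; omega

/-- horizontal positions are nearly linear in the slope -/
theorem VX_approx {c : ℤ} {Q P VX VY : ℤ → ℤ} (h : Chain c Q P VX VY) (hQ0 : Q 0 = 1) (hP0 : P 0 = 0)
    (hV : VX 0 = 0) (t : ℕ) (ht : (t : ℤ) = 2 * c + 1) (k : ℕ) :
    |(VX k : ℝ) - (P k : ℝ) / Q k * HH t| ≤ om t := by
  have hq : (0:ℝ) < Q k := by exact_mod_cast h.pos k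
  have hp : (0:ℝ) ≤ P k := by exact_mod_cast P_nonneg h hQ0 hP0 k
  have := farey_count t ((P k : ℝ) / Q k) (by positivity)
  rw [VX_eq h hQ0 hP0 hV t ht k]
  rw [Int.cast_sum]
  convert this using 4 with q hq
  rw [Int.cast_natCast, Nat.cast_mul, Nat.cast_mul]

/-- The slope of an edge direction. -/
noncomputable def sg (Q P : ℤ → ℤ) (j : ℤ) : ℝ := (P j : ℝ) / Q j
/-- The support value. -/
noncomputable def gg (Q P VX VY : ℤ → ℤ) (j : ℤ) : ℝ := sg Q P j * VX j - VY j

theorem WW_iff {c : ℤ} {Q P VX VY : ℤ → ℤ} (h : Chain c Q P VX VY) (z : ℤ × ℤ) :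
    z ∈ WW c Q P VX VY 0 ↔ ∀ j, sg Q P j * z.1 - gg Q P VX VY j ≤ z.2 := by
  unfold WW
  rw [Set.mem_ofPred_eq]
  apply forall_congr'
  intro j
  have hq : (0:ℝ) < Q j := by exact_mod_cast h.pos j
  have e : Lev c Q P VX VY j 0 = Q j * VY j - P j * VX j := by
    simp [Lev, zx, zy, dxi, deta]
  rw [e]
  have e2 : sg Q P j * Q j = P j := by unfold sg; field_simp
  unfold gg
  constructor
  · intro hh
    have hh' : (Q j * VY j - P j * VX j : ℝ) ≤ Q j * z.2 - P j * z.1 := by exact_mod_cast hh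
    rw [← e2] at hh'
    have : 0 ≤ (Q j : ℝ) * (z.2 - (sg Q P j * z.1 - (sg Q P j * VX j - VY j))) := by linarith
    have := nonneg_of_mul_nonneg_right this hq
    linarith
  · intro hh
    have := mul_le_mul_of_nonneg_left hh hq.le
    have hh' : (Q j * VY j - P j * VX j : ℝ) ≤ Q j * z.2 - P j * z.1 := by
      rw [← e2]; linarith
    exact_mod_cast hh'

theorem sg_step {c : ℤ} {Q P VX VY : ℤ → ℤ} (h : Chain c Q P VX VY) {t : ℕ}
    (ht : (t : ℤ) = 2 * c + 1) (j : ℤ) :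
    1 / (t:ℝ)^2 ≤ sg Q P (j+1) - sg Q P j ∧ sg Q P (j+1) - sg Q P j ≤ 1 / t := by
  have h1 : (1:ℝ) ≤ Q j := by exact_mod_cast h.pos j
  have h2 : (1:ℝ) ≤ Q (j+1) := by exact_mod_cast h.pos (j+1)
  have h3 : (Q j:ℝ) ≤ t := by have := h.le j; rw [← ht] at this; exact_mod_cast this
  have h4 : (Q (j+1):ℝ) ≤ t := by have := h.le (j+1); rw [← ht] at this; exact_mod_cast this
  have h5 : (t:ℝ) + 1 ≤ Q j + Q (j+1) := by
    have := h.sum j; rw [← ht] at this; exact_mod_cast this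
  have d : (Q j * P (j+1) - P j * Q (j+1) : ℝ) = 1 := by exact_mod_cast h.det j
  have e : sg Q P (j+1) - sg Q P j = 1 / (Q j * Q (j+1)) := by
    unfold sg; rw [← d]; field_simp
  have tp : (0:ℝ) < t := by linarith
  rw [e]
  constructor
  · apply one_div_le_one_div_of_le (by positivity)
    nlinarith
  · apply one_div_le_one_div_of_le (by positivity)
    nlinarith

theorem gg_step {c : ℤ} {Q P VX VY : ℤ → ℤ} (h : Chain c Q P VX VY) (j : ℤ) :
    gg Q P VX VY (j+1) - gg Q P VX VY j = (sg Q P (j+1) - sg Q P j) * VX j := by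
  have hq : (0:ℝ) < Q (j+1) := by exact_mod_cast h.pos (j+1)
  have e2 : sg Q P (j+1) * Q (j+1) = P (j+1) := by unfold sg; field_simp
  unfold gg
  rw [h.vx j, h.vy j]
  push_cast
  rw [← e2]
  ring

theorem sg_nat_ge {c : ℤ} {Q P VX VY : ℤ → ℤ} (h : Chain c Q P VX VY) (hP0 : P 0 = 0) {t : ℕ}
    (ht : (t : ℤ) = 2 * c + 1) (k : ℕ) : (k:ℝ) / (t:ℝ)^2 ≤ sg Q P k := by
  induction k with
  | zero => simp [sg, hP0]
  | succ k ih =>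
    have := (sg_step h ht k).1
    push_cast
    rw [add_div]
    linarith

theorem gg_nat {c : ℤ} {Q P VX VY : ℤ → ℤ} (h : Chain c Q P VX VY) (hQ0 : Q 0 = 1) (hP0 : P 0 = 0)
    (hV : VX 0 = 0) (hV' : VY 0 = 0) (t : ℕ) (ht : (t : ℤ) = 2 * c + 1) (k : ℕ) :
    |gg Q P VX VY k - HH t * sg Q P k ^ 2 / 2| ≤ (om t + HH t / (2 * t)) * sg Q P k := by
  have H0 : 0 ≤ HH t := by unfold HH; positivity
  induction k with
  | zero => simp [sg, gg, hP0, hV, hV']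
  | succ k ih =>
    have e := gg_step h k
    have v := VX_approx h hQ0 hP0 hV t ht k
    obtain ⟨s1, s2⟩ := sg_step h ht k
    have s0 : 0 ≤ sg Q P (k+1) - sg Q P k := le_trans (by positivity) s1
    push_cast
    obtain ⟨Δ, hΔ⟩ : ∃ Δ, Δ = sg Q P (k+1) - sg Q P k := ⟨_, rfl⟩
    rw [← hΔ] at e s0 s2
    have e3 : sg Q P (k+1) = sg Q P k + Δ := by rw [hΔ]; ring
    have e4 : gg Q P VX VY (k+1) = gg Q P VX VY k + Δ * VX k := by linarith
    rw [e3, e4]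
    change |(VX k : ℝ) - sg Q P k * HH t| ≤ om t at v
    have m1 : |Δ * ((VX k : ℝ) - sg Q P k * HH t)| ≤ Δ * om t := by
      rw [abs_mul, abs_of_nonneg s0]; gcongr
    have m2 : |HH t * Δ ^ 2 / 2| ≤ Δ * (HH t / (2 * t)) := by
      rw [abs_of_nonneg (by positivity)]
      have : Δ * (HH t / (2 * t)) = HH t * Δ / 2 * (1 / t) := by ring
      rw [this]
      have : HH t * Δ ^ 2 / 2 = HH t * Δ / 2 * Δ := by ring
      rw [this]; gcongr
    rw [abs_le] at *
    constructor <;> nlinarith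

/-- The model set for odd parameter. -/
def W0 (c : ℕ) : Set (ℤ × ℤ) :=
  WW c (cQ (2*c+1)) (cP (2*c+1)) (cVX (2*c+1)) (cVY (2*c+1)) 0

theorem exists_slope {c : ℤ} {Q P VX VY : ℤ → ℤ} (h : Chain c Q P VX VY) (hP0 : P 0 = 0) {t : ℕ}
    (ht : (t : ℤ) = 2 * c + 1) (hneg : ∀ k : ℕ, sg Q P (-k) = - sg Q P k) (s : ℝ) :
    ∃ j, |sg Q P j - s| ≤ 1 / t := by
  have tp : (0:ℝ) < t := by
    have := h.hc
    have : (0:ℤ) < t := by omega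
    exact_mod_cast this
  obtain ⟨N, hN⟩ := exists_nat_ge (|s| * (t:ℝ)^2)
  have hN2 : |s| ≤ sg Q P N := by
    refine le_trans ?_ (sg_nat_ge h hP0 ht N)
    rw [le_div_iff₀ (by positivity)]; exact hN
  have mono := (slope_lt h).monotone
  have hle : ∃ j, sg Q P j ≤ s := ⟨-N, by rw [hneg]; linarith [neg_abs_le s]⟩
  have hbd : ∃ b : ℤ, ∀ j, sg Q P j ≤ s → j ≤ b := by
    refine ⟨N, fun j hj => ?_⟩
    by_contra hlt
    push Not at hlt
    have := (slope_lt h) hlt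
    change sg Q P N < sg Q P j at this
    linarith [le_abs_self s]
  obtain ⟨j, hj, hmax⟩ := Int.exists_greatest_of_bdd hbd hle
  refine ⟨j, ?_⟩
  have := (sg_step h ht j).2
  have h2 : s < sg Q P (j+1) := by
    by_contra hh
    have := hmax (j+1) (not_lt.mp hh)
    omega
  rw [abs_le]
  constructor <;> linarith

theorem model : ∃ C : ℝ, 1 ≤ C ∧ ∀ c : ℕ, ∃ σ g : ℤ → ℝ,
    (∀ z : ℤ × ℤ, z ∈ W0 c ↔ ∀ j, σ j * z.1 - g j ≤ z.2) ∧
    (∀ j, |g j - HH (2*c+1) * σ j ^ 2 / 2| ≤ C * om (2*c+1) * |σ j|) ∧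
    (∀ s : ℝ, ∃ j, |σ j - s| ≤ 1 / ((2*c+1 : ℕ) : ℝ)) := by
  obtain ⟨C, hC, hH⟩ := HH_approx
  refine ⟨2 + AA + C, by linarith [AA_pos], fun c => ?_⟩
  have h := cchain c (by positivity)
  have ht : ((2*c+1 : ℕ) : ℤ) = 2 * (c:ℤ) + 1 := by push_cast; ring
  obtain ⟨t, et⟩ : ∃ t : ℕ, t = 2*c+1 := ⟨_, rfl⟩
  have tp : 0 < t := by omega
  rw [← et] at ht ⊢
  unfold W0
  rw [← ht] at h ⊢
  have e0 := cQ_zero t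
  have hQn := cQ_neg t
  have hneg : ∀ k : ℕ, sg (cQ t) (cP t) (-k) = - sg (cQ t) (cP t) k := by
    intro k
    unfold sg
    rw [cQ_neg, cP_neg]; push_cast; ring
  have t1 : (1:ℝ) ≤ t := by exact_mod_cast tp
  have og := om_ge t tp
  have o0 : 0 ≤ om t := le_trans (by positivity) og
  have hE : om t + HH t / (2 * t) ≤ (1 + AA + C) * om t := by
    have := (abs_le.mp (hH t tp)).2
    have : HH t / (2 * t) ≤ (AA + C) * om t := by
      rw [div_le_iff₀ (by positivity)]
      have a1 : AA * (t:ℝ)^3 ≤ AA * om t * t := by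
        have := mul_le_mul_of_nonneg_left og (mul_nonneg AA_pos.le (by linarith : (0:ℝ) ≤ t))
        nlinarith
      have a2 : C * om t ≤ C * om t * t := le_mul_of_one_le_right (by positivity) t1
      have a3 : 0 ≤ (AA + C) * om t * t := by have := AA_pos; positivity
      nlinarith
    linarith
  have key : ∀ k : ℕ, |gg (cQ t) (cP t) (cVX t) (cVY t) k - HH t * sg (cQ t) (cP t) k ^ 2 / 2|
      ≤ (1 + AA + C) * om t * sg (cQ t) (cP t) k := by
    intro k
    refine (gg_nat h (cQ_zero _) (cP_zero _) (cVX_zero _) (cVY_zero _) t ht k).trans ?_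
    have : 0 ≤ sg (cQ t) (cP t) k :=
      le_trans (by positivity) (sg_nat_ge h (cP_zero _) ht k)
    gcongr
  refine ⟨sg (cQ t) (cP t), gg (cQ t) (cP t) (cVX t) (cVY t), fun z => ?_, fun j => ?_, fun s => ?_⟩
  · exact WW_iff h z
  · rcases le_or_gt 0 j with hj | hj
    · obtain ⟨k, rfl⟩ := Int.eq_ofNat_of_zero_le hj
      have s0 : 0 ≤ sg (cQ t) (cP t) k :=
        le_trans (by positivity) (sg_nat_ge h (cP_zero _) ht k)
      rw [abs_of_nonneg s0]
      refine (key k).trans ?_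
      gcongr
      linarith
    · obtain ⟨k, hk⟩ : ∃ k : ℕ, j = -1 - (k:ℤ) := ⟨(-1 - j).toNat, by omega⟩
      have s0 : 0 ≤ sg (cQ t) (cP t) (k+1) := by
        have := sg_nat_ge h (cP_zero _) ht (k+1)
        push_cast at this
        exact le_trans (by positivity) this
      have e1 : sg (cQ t) (cP t) j = - sg (cQ t) (cP t) (k+1) := by
        rw [hk]
        have := hneg (k+1)
        push_cast at this
        rw [← this]; congr 1; ring
      have e2 : gg (cQ t) (cP t) (cVX t) (cVY t) j =
          gg (cQ t) (cP t) (cVX t) (cVY t) (k+1) + t * sg (cQ t) (cP t) (k+1) := by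
        have := gg_step h k
        have e3 : gg (cQ t) (cP t) (cVX t) (cVY t) j =
          sg (cQ t) (cP t) (k+1) * (t + cVX t k) - cVY t k := by
          unfold gg
          rw [e1, hk, cVX_neg, cVY_neg]; push_cast; ring
        rw [e3]
        have e4 : gg (cQ t) (cP t) (cVX t) (cVY t) k = sg (cQ t) (cP t) k * cVX t k - cVY t k := rfl
        rw [e4] at this
        linarith
      have kk := key (k+1)
      push_cast at kk
      rw [e1, e2, abs_neg, abs_of_nonneg s0]
      have tom : (t:ℝ) ≤ om t := le_trans (by nlinarith) og
      have := mul_le_mul_of_nonneg_right tom s0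
      have p : 0 ≤ t * sg (cQ t) (cP t) (k+1) := by positivity
      rw [abs_le] at *
      constructor <;> nlinarith
  · exact exists_slope h (cP_zero _) ht hneg s

theorem quad_min (ω E s : ℝ) (hω : 0 < ω) : (E) * s - ω * s ^ 2 / 2 ≤ E ^ 2 / (2 * ω) := by
  rw [le_div_iff₀ (by positivity)]
  nlinarith [sq_nonneg (E - ω * s)]

theorem EE_bd (D E ω : ℝ) (hD : 1 ≤ D) (hω : 1 ≤ ω) (hE0 : 0 ≤ E) (hE : E ≤ D * ω) :
    (E + 1) ^ 2 / (2 * ω) ≤ 2 * D ^ 2 * ω := by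
  rw [div_le_iff₀ (by positivity)]
  have : E + 1 ≤ 2 * D * ω := by nlinarith
  calc (E+1)^2 ≤ (2 * D * ω)^2 := by gcongr
    _ = _ := by ring

theorem inclA (D E ω K H t θ σ g x y : ℝ) (hD : 1 ≤ D) (hω : 1 ≤ ω) (hE0 : 0 ≤ E) (hE : E ≤ D * ω)
    (ht : 1 ≤ t) (htω : t ^ 2 ≤ ω) (hH : 3 ≤ H) (hHt : H ≤ D * t ^ 3) (hK : K + ω ≤ H)
    (hθ0 : 0 ≤ θ) (hθ1 : θ ≤ 1) (hg : |g - K * σ ^ 2 / 2| ≤ E * |σ|) (hs : |σ - x / H| ≤ 1 / t)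
    (hy : σ * x - g ≤ y) : (x - θ) ^ 2 / (2 * H) - 5 * D ^ 2 * ω ≤ y := by
  obtain ⟨s, hsx⟩ : ∃ s, s = x / H := ⟨_, rfl⟩
  have hx : x = s * H := by rw [hsx]; field_simp
  rw [← hsx] at hs
  have q1 := quad_min ω (E + 1) |σ| (by linarith)
  have q2 := EE_bd D E ω hD hω hE0 hE
  rw [sq_abs] at q1
  have q3 := (abs_le.mp hg).2
  have e1 : (x - θ) ^ 2 / (2 * H) = s ^ 2 * H / 2 - θ * s + θ ^ 2 / (2 * H) := by
    rw [hx]; field_simp; ring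
  have e2 : θ ^ 2 / (2 * H) ≤ 1 := by
    rw [div_le_iff₀ (by positivity)]; nlinarith
  have i1 : 1 / t ≤ 1 := by rw [div_le_iff₀ (by linarith)]; linarith
  have e3 : |s| ≤ |σ| + 1 := by
    have := abs_sub_abs_le_abs_sub s σ
    rw [abs_sub_comm] at this
    linarith
  have e4 : - (θ * s) ≤ |s| := by
    calc -(θ * s) ≤ |θ * s| := neg_le_abs _
      _ = θ * |s| := by rw [abs_mul, abs_of_nonneg hθ0]
      _ ≤ 1 * |s| := by gcongr
      _ = |s| := one_mul _
  have e5 : H * (σ - s) ^ 2 ≤ D * ω := by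
    have : (σ - s)^2 ≤ (1/t)^2 := by rw [← sq_abs]; gcongr
    calc H * (σ - s)^2 ≤ (D * t^3) * (1/t)^2 := by gcongr
      _ = D * t := by field_simp
      _ ≤ D * ω := by gcongr; nlinarith
  have e6 : σ * x - H * σ ^ 2 / 2 = s ^ 2 * H / 2 - H * (σ - s) ^ 2 / 2 := by rw [hx]; ring
  have e7 : K * σ^2 ≤ (H - ω) * σ^2 := by gcongr; linarith
  have d1 : D * ω ≤ D ^ 2 * ω := by nlinarith [mul_nonneg (by linarith : (0:ℝ) ≤ D - 1) (by positivity : 0 ≤ D * ω)]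
  have d2 : ω ≤ D * ω := by nlinarith
  rw [e1]
  linarith

theorem inclB (D E ω K H θ σ g x y : ℝ) (hD : 1 ≤ D) (hω : 1 ≤ ω) (hE0 : 0 ≤ E) (hE : E ≤ D * ω)
    (hK0 : 0 < K) (hH : 3 ≤ H) (hKH : K ≤ H) (hHK : H - K ≤ D * ω) (hHK2 : H ≤ D * K)
    (hωK : ω ≤ D * K)
    (hθ0 : 0 ≤ θ) (hθ1 : θ ≤ 1) (hg : |g - K * σ ^ 2 / 2| ≤ E * |σ|) (hx : |x| ≤ H)
    (hy : (x - θ) ^ 2 / (2 * H) + 3 * D ^ 3 * ω ≤ y) : σ * x - g ≤ y := by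
  have q1 := quad_min K (|x| + E) |σ| hK0
  rw [sq_abs] at q1
  have q3 := (abs_le.mp hg).1
  have a1 : σ * x ≤ |σ| * |x| := by rw [← abs_mul]; exact le_abs_self _
  have a2 : (|x| + E) ^ 2 / (2 * K) = x^2 / (2*H) + (x^2/(2*K) - x^2/(2*H)) + |x| * E / K + E^2 / (2*K) := by
    rw [add_sq, sq_abs]; field_simp; ring
  have b1 : x^2/(2*K) - x^2/(2*H) ≤ D^2 * ω / 2 := by
    have : x^2/(2*K) - x^2/(2*H) = x^2 * (H - K) / (2 * K * H) := by field_simp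
    rw [this, div_le_iff₀ (by positivity)]
    calc x^2 * (H - K) ≤ H^2 * (D * ω) := by
          rw [← sq_abs]
          have : 0 ≤ H - K := by linarith
          gcongr
      _ = H * (H * (D * ω)) := by ring
      _ ≤ (D * K) * (H * (D * ω)) := by gcongr
      _ = D^2 * ω / 2 * (2 * K * H) := by ring
  have b2 : |x| * E / K ≤ D^2 * ω := by
    rw [div_le_iff₀ hK0]
    calc |x| * E ≤ (D * K) * (D * ω) := by gcongr; linarith
      _ = _ := by ring
  have b3 : E^2 / (2*K) ≤ D^3 * ω / 2 := by
    rw [div_le_iff₀ (by positivity)]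
    calc E^2 ≤ (D * ω)^2 := by gcongr
      _ = D^2 * ω * ω := by ring
      _ ≤ D^2 * ω * (D * K) := by gcongr
      _ = _ := by ring
  have b4 : x^2 / (2*H) - 1 ≤ (x - θ)^2 / (2*H) := by
    rw [sub_le_iff_le_add, ← sub_le_iff_le_add', ← sub_div, div_le_iff₀ (by positivity)]
    have : θ * x ≤ 1 * |x| := by
      calc θ * x ≤ |θ * x| := le_abs_self _
        _ = θ * |x| := by rw [abs_mul, abs_of_nonneg hθ0]
        _ ≤ 1 * |x| := by gcongr
    nlinarith [sq_nonneg θ]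
  have d0 : ω ≤ D * ω := by nlinarith
  have d1 : D * ω ≤ D ^ 2 * ω := by nlinarith [mul_nonneg (by linarith : (0:ℝ) ≤ D - 1) (by positivity : 0 ≤ D * ω)]
  have d2 : D^2 * ω ≤ D ^ 3 * ω := by nlinarith [mul_nonneg (by linarith : (0:ℝ) ≤ D - 1) (by positivity : 0 ≤ D^2 * ω)]
  linarith

theorem inclC (D E ω K H θ σ g x y : ℝ) (hD : 1 ≤ D) (hω : 1 ≤ ω) (hE0 : 0 ≤ E) (hE : E ≤ D * ω)
    (hH : 3 ≤ H) (hK : H ≤ K - ω)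
    (hθ0 : 0 ≤ θ) (hθ1 : θ ≤ 1) (hg : |g - K * σ ^ 2 / 2| ≤ E * |σ|)
    (hy : (x - θ) ^ 2 / (2 * H) + 2 * D ^ 2 * ω ≤ y) : σ * x - g ≤ y := by
  have q1 := quad_min ω (E + 1) |σ| (by linarith)
  have q2 := EE_bd D E ω hD hω hE0 hE
  have q4 := quad_min H (x - θ) σ (by linarith)
  rw [sq_abs] at q1
  have q3 := (abs_le.mp hg).1
  have e4 : σ * θ ≤ |σ| := by
    calc σ * θ ≤ |σ * θ| := le_abs_self _
      _ = |σ| * θ := by rw [abs_mul, abs_of_nonneg hθ0]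
      _ ≤ |σ| * 1 := by gcongr
      _ = |σ| := mul_one _
  have e7 : (H + ω) * σ^2 ≤ K * σ^2 := by gcongr; linarith
  linarith

theorem inclD (D E ω K H t θ σ g x y : ℝ) (hD : 1 ≤ D) (hω : 1 ≤ ω) (hE0 : 0 ≤ E) (hE : E ≤ D * ω)
    (ht : 1 ≤ t) (htω : t ^ 2 ≤ ω) (hH : 3 ≤ H) (hHt : H ≤ D * t ^ 3) (hHK : H ≤ K)
    (hKH : K - H ≤ D * ω)
    (hθ0 : 0 ≤ θ) (hθ1 : θ ≤ 1) (hg : |g - K * σ ^ 2 / 2| ≤ E * |σ|) (hs : |σ - x / H| ≤ 1 / t)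
    (hx : |x| ≤ H)
    (hy : σ * x - g ≤ y) : (x - θ) ^ 2 / (2 * H) - 7 * D * ω ≤ y := by
  obtain ⟨s, hsx⟩ : ∃ s, s = x / H := ⟨_, rfl⟩
  have hxs : x = s * H := by rw [hsx]; field_simp
  rw [← hsx] at hs
  have q3 := (abs_le.mp hg).2
  have e1 : (x - θ) ^ 2 / (2 * H) = s ^ 2 * H / 2 - θ * s + θ ^ 2 / (2 * H) := by
    rw [hxs]; field_simp; ring
  have e2 : θ ^ 2 / (2 * H) ≤ 1 := by
    rw [div_le_iff₀ (by positivity)]; nlinarith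
  have i1 : 1 / t ≤ 1 := by rw [div_le_iff₀ (by linarith)]; linarith
  have s1 : |s| ≤ 1 := by
    rw [hsx, abs_div, abs_of_nonneg (by linarith : 0 ≤ H), div_le_iff₀ (by linarith)]; linarith
  have e3 : |σ| ≤ 2 := by
    have := abs_sub_abs_le_abs_sub σ s
    linarith
  have e4 : - (θ * s) ≤ 1 := by
    calc -(θ * s) ≤ |θ * s| := neg_le_abs _
      _ = θ * |s| := by rw [abs_mul, abs_of_nonneg hθ0]
      _ ≤ 1 * 1 := by gcongr
      _ = 1 := one_mul _
  have e5 : H * (σ - s) ^ 2 ≤ D * ω := by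
    have : (σ - s)^2 ≤ (1/t)^2 := by rw [← sq_abs]; gcongr
    calc H * (σ - s)^2 ≤ (D * t^3) * (1/t)^2 := by gcongr
      _ = D * t := by field_simp
      _ ≤ D * ω := by gcongr; nlinarith
  have e6 : σ * x - H * σ ^ 2 / 2 = s ^ 2 * H / 2 - H * (σ - s) ^ 2 / 2 := by rw [hxs]; ring
  have e7 : (K - H) * σ^2 ≤ D * ω * 4 := by
    have : σ^2 ≤ 4 := by rw [← sq_abs]; nlinarith [abs_nonneg σ]
    have h0 : 0 ≤ K - H := by linarith
    gcongr
  have e8 : E * |σ| ≤ D * ω * 2 := by gcongr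
  have d2 : ω ≤ D * ω := by nlinarith
  rw [e1]
  linarith

theorem om_small (D δ : ℝ) (hD : 0 ≤ D) (hδ : 0 < δ) :
    ∃ M : ℝ, 0 ≤ M ∧ ∀ t : ℕ, 0 < t → D * om t ≤ δ * (t:ℝ)^3 + M := by
  obtain ⟨L, hL1, hL⟩ : ∃ L : ℝ, 1 ≤ L ∧ D / L ≤ δ / 2 := by
    refine ⟨2 * D / δ + 1, by have : 0 ≤ 2 * D / δ := by positivity
                              linarith, ?_⟩
    have : 0 ≤ 2 * D / δ := by positivity
    rw [div_le_iff₀ (by linarith)]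
    have : δ / 2 * (2 * D / δ + 1) = D + δ / 2 := by field_simp
    linarith
  obtain ⟨A, hA⟩ : ∃ A, A = D * Real.log L := ⟨_, rfl⟩
  have hA0 : 0 ≤ A := by rw [hA]; exact mul_nonneg hD (Real.log_nonneg hL1)
  refine ⟨A * (2 * A / δ)^2, by positivity, fun t ht => ?_⟩
  have tp : (0:ℝ) < t := by exact_mod_cast ht
  have h1 : Real.log t ≤ Real.log L + t / L - 1 := by
    have := Real.log_le_sub_one_of_pos (show 0 < (t:ℝ) / L by positivity)
    rw [Real.log_div (by positivity) (by positivity)] at this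
    linarith
  have h2 : D * (1 + Real.log t) ≤ A + δ / 2 * t := by
    calc D * (1 + Real.log t) ≤ D * (Real.log L + t / L) := by
          apply mul_le_mul_of_nonneg_left _ hD; linarith
      _ = A + D / L * t := by rw [hA]; ring
      _ ≤ _ := by gcongr
  have h3 : A * (t:ℝ)^2 ≤ δ / 2 * (t:ℝ)^3 + A * (2 * A / δ)^2 := by
    rcases le_total (2 * A / δ) (t:ℝ) with h | h
    · have : A ≤ δ / 2 * t := by
        rw [div_le_iff₀ hδ] at h; linarith
      have := mul_le_mul_of_nonneg_right this (sq_nonneg (t:ℝ))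
      have : 0 ≤ A * (2 * A / δ)^2 := by positivity
      nlinarith
    · have : A * (t:ℝ)^2 ≤ A * (2 * A / δ)^2 := by gcongr
      have : 0 ≤ δ / 2 * (t:ℝ)^3 := by positivity
      linarith
  have := mul_le_mul_of_nonneg_right h2 (sq_nonneg (t:ℝ))
  unfold om
  nlinarith

theorem om_one : om 1 = 1 := by simp [om]
theorem HH_one : HH 1 = 1 := by simp [HH]

theorem HH_ge_one (t : ℕ) (ht : 0 < t) : 1 ≤ HH t := by
  unfold HH
  have : (((1:ℕ):ℝ)*((t/1:ℕ):ℝ)*(Nat.totient 1 : ℝ)) ≤ ∑ q ∈ Finset.Ioc 0 t, (q:ℝ)*((t/q:ℕ):ℝ)*(Nat.totient q) := by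
    apply Finset.single_le_sum (f := fun q : ℕ => (q:ℝ)*((t/q:ℕ):ℝ)*(Nat.totient q : ℝ))
    · intro i _; positivity
    · simp; omega
  refine le_trans ?_ this
  simp; omega

theorem om_mono {s t : ℕ} (hs : 0 < s) (hst : s ≤ t) : om s ≤ om t := by
  have s1 : (1:ℝ) ≤ s := by exact_mod_cast hs
  have st : (s:ℝ) ≤ t := by exact_mod_cast hst
  have := Real.log_nonneg s1
  have := Real.log_le_log (by linarith) st
  unfold om
  gcongr

theorem om_two (t : ℕ) (ht : 0 < t) : om (t+2) ≤ 27 * om t := by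
  have s1 : (1:ℝ) ≤ t := by exact_mod_cast ht
  have l0 := Real.log_nonneg s1
  have l1 : Real.log ((t+2:ℕ):ℝ) ≤ 2 + Real.log t := by
    have : ((t+2:ℕ):ℝ) ≤ 3 * t := by push_cast; linarith
    have := Real.log_le_log (by positivity) this
    rw [Real.log_mul (by norm_num) (by positivity)] at this
    have := Real.log_le_sub_one_of_pos (show (0:ℝ) < 3 by norm_num)
    linarith
  unfold om
  have : ((t+2:ℕ):ℝ)^2 ≤ 9 * (t:ℝ)^2 := by push_cast; nlinarith
  calc ((t+2:ℕ):ℝ)^2 * (1 + Real.log ((t+2:ℕ):ℝ)) ≤ (9 * (t:ℝ)^2) * (1 + (2 + Real.log t)) := by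
        have : 0 ≤ Real.log ((t+2:ℕ):ℝ) := Real.log_nonneg (by push_cast; linarith)
        gcongr
    _ ≤ (9 * (t:ℝ)^2) * (3 * (1 + Real.log t)) := by gcongr; linarith
    _ = _ := by ring

/-- Comparability of the size and the parameter. -/
def Good (D H : ℝ) (t : ℕ) : Prop :=
  |H - AA * (t:ℝ)^3| ≤ D * om t ∧ |H - HH t| ≤ D * om t ∧ H ≤ D * (t:ℝ)^3 ∧ H ≤ D * HH t ∧
    om t ≤ D * HH t ∧ (t:ℝ)^3 ≤ D * H

theorem om_le_cube (t : ℕ) (ht : 0 < t) : om t ≤ (t:ℝ)^3 := by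
  have tp : (0:ℝ) < t := by exact_mod_cast ht
  have := Real.log_le_sub_one_of_pos tp
  unfold om
  calc (t:ℝ)^2 * (1 + Real.log t) ≤ (t:ℝ)^2 * t := by gcongr; linarith
    _ = _ := by ring

theorem good_of (D₀ : ℝ) (hD₀ : 0 ≤ D₀) : ∃ D, 1 ≤ D ∧ ∀ (H : ℝ) (t : ℕ), 3 ≤ H → 0 < t →
    |H - AA * (t:ℝ)^3| ≤ D₀ * om t → Good D H t := by
  obtain ⟨C, hC, hH⟩ := HH_approx
  have A0 := AA_pos
  obtain ⟨M, hM0, hM⟩ := om_small (C + D₀) (AA/2) (by linarith) (by linarith)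
  obtain ⟨F, hF⟩ : ∃ F, F = 2 / AA * (1 + M) := ⟨_, rfl⟩
  have F0 : 0 ≤ F := by rw [hF]; positivity
  have G0 : 0 ≤ AA + D₀ := by linarith
  refine ⟨1 + C + D₀ + AA + F + (AA + D₀) * F, by
    have : 0 ≤ (AA + D₀) * F := by positivity
    linarith, fun H t hH3 ht hd => ?_⟩
  have tp : (1:ℝ) ≤ t := by exact_mod_cast ht
  have og := om_ge t ht
  have o0 : 0 ≤ om t := le_trans (by positivity) og
  have h1 := hH t ht
  have h2 := om_le_cube t ht
  have h3 := hM t ht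
  have h4 := HH_ge_one t ht
  have c0 : 0 ≤ C * om t := by positivity
  have d0 : 0 ≤ D₀ * om t := by positivity
  have GF : 0 ≤ (AA + D₀) * F := by positivity
  have t0 : 0 ≤ (t:ℝ)^3 := by positivity
  have k1 : (t:ℝ)^3 ≤ F * HH t := by
    have : AA / 2 * (t:ℝ)^3 ≤ HH t + M := by nlinarith [(abs_le.mp h1).1]
    have : AA / 2 * (t:ℝ)^3 ≤ (1 + M) * HH t := by nlinarith
    have := mul_le_mul_of_nonneg_left this (show 0 ≤ 2 / AA by positivity)
    rw [hF]
    calc (t:ℝ)^3 = 2 / AA * (AA / 2 * (t:ℝ)^3) := by field_simp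
      _ ≤ _ := this
      _ = _ := by ring
  have k2 : (t:ℝ)^3 ≤ F * H := by
    have : AA / 2 * (t:ℝ)^3 ≤ H + M := by nlinarith [(abs_le.mp hd).1]
    have : AA / 2 * (t:ℝ)^3 ≤ (1 + M) * H := by nlinarith
    have := mul_le_mul_of_nonneg_left this (show 0 ≤ 2 / AA by positivity)
    rw [hF]
    calc (t:ℝ)^3 = 2 / AA * (AA / 2 * (t:ℝ)^3) := by field_simp
      _ ≤ _ := this
      _ = _ := by ring
  have k3 : H ≤ (AA + D₀) * (t:ℝ)^3 := by nlinarith [(abs_le.mp hd).2]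
  obtain ⟨D, hDD⟩ : ∃ D, D = 1 + C + D₀ + AA + F + (AA + D₀) * F := ⟨_, rfl⟩
  rw [← hDD]
  have x1 : D₀ ≤ D := by linarith
  have x2 : C + D₀ ≤ D := by linarith
  have x3 : AA + D₀ ≤ D := by linarith
  have x4 : (AA + D₀) * F ≤ D := by linarith
  have x5 : F ≤ D := by linarith
  refine ⟨hd.trans (by gcongr), ?_, k3.trans (by gcongr), ?_, ?_, k2.trans (by gcongr)⟩
  · refine le_trans ?_ (mul_le_mul_of_nonneg_right x2 o0)
    rw [abs_le] at *
    constructor <;> linarith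
  · refine le_trans ?_ (mul_le_mul_of_nonneg_right x4 (by linarith))
    rw [mul_assoc]
    exact k3.trans (by gcongr)
  · exact (h2.trans k1).trans (by gcongr)

theorem params : ∃ D, 1 ≤ D ∧ ∀ H : ℝ, 3 ≤ H →
    (∃ c : ℕ, HH (2*c+1) + om (2*c+1) ≤ H ∧ Good D H (2*c+1)) ∧
    (∃ c : ℕ, H ≤ HH (2*c+1) - om (2*c+1) ∧ Good D H (2*c+1)) := by
  obtain ⟨C, hC, hH⟩ := HH_approx
  have A0 := AA_pos
  obtain ⟨D, hD, hgood⟩ := good_of (26 * AA + 27 * (C + 1)) (by positivity)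
  obtain ⟨M, hM0, hM⟩ := om_small (C + 1) (AA/2) (by linarith) (by linarith)
  refine ⟨D, hD, fun H hH3 => ⟨?_, ?_⟩⟩
  · have hex : ∃ c : ℕ, H < HH (2*c+3) + om (2*c+3) := by
      obtain ⟨N, hN⟩ := exists_nat_ge H
      refine ⟨N, ?_⟩
      have := HH_ge_one (2*N+3) (by omega)
      have := om_ge (2*N+3) (by omega)
      push_cast at this
      nlinarith [(Nat.cast_nonneg N : (0:ℝ) ≤ N)]
    classical
    obtain ⟨c, hc1, hc2⟩ : ∃ c : ℕ, H < HH (2*c+3) + om (2*c+3) ∧ HH (2*c+1) + om (2*c+1) ≤ H := by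
      refine ⟨Nat.find hex, Nat.find_spec hex, ?_⟩
      rcases Nat.eq_zero_or_pos (Nat.find hex) with h0 | h0
      · rw [h0]
        have a := HH_one
        have b := om_one
        simp only [mul_zero, zero_add]
        linarith
      · have := Nat.find_min hex (m := Nat.find hex - 1) (by omega)
        rw [show 2 * (Nat.find hex - 1) + 3 = 2 * Nat.find hex + 1 by omega] at this
        linarith
    refine ⟨c, hc2, hgood H _ hH3 (by omega) ?_⟩
    rw [show 2*c+3 = (2*c+1)+2 by ring] at hc1
    obtain ⟨t, et⟩ : ∃ t : ℕ, t = 2*c+1 := ⟨_, rfl⟩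
    have tp : 0 < t := by omega
    rw [← et] at hc1 hc2 ⊢
    have t1 : (1:ℝ) ≤ t := by exact_mod_cast tp
    have a1 := (abs_le.mp (hH t tp)).1
    have a2 := (abs_le.mp (hH (t+2) (by omega))).2
    have o2 := om_two t tp
    have og := om_ge t tp
    have o0 : 0 ≤ om t := le_trans (by positivity) og
    push_cast at a2
    have a3 : ((t:ℝ)+2)^3 ≤ (t:ℝ)^3 + 26 * om t := by nlinarith
    have a4 := mul_le_mul_of_nonneg_left a3 A0.le
    have a5 := mul_le_mul_of_nonneg_left o2 (by linarith : 0 ≤ C + 1)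
    have a6 : 0 ≤ AA * om t := by positivity
    have a7 : 0 ≤ C * om t := by positivity
    rw [abs_le]
    constructor <;> nlinarith
  · have hex : ∃ c : ℕ, H ≤ HH (2*c+1) - om (2*c+1) := by
      obtain ⟨N, hN⟩ := exists_nat_ge (2 / AA * (H + M))
      refine ⟨N, ?_⟩
      have a1 := (abs_le.mp (hH (2*N+1) (by omega))).1
      have a2 := hM (2*N+1) (by omega)
      have : (N:ℝ) ≤ ((2*N+1:ℕ):ℝ)^3 := by exact_mod_cast (show N ≤ (2*N+1)^3 by
        calc N ≤ (2*N+1)^1 := by rw [pow_one]; omega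
          _ ≤ _ := Nat.pow_le_pow_right (by omega) (by norm_num))
      have := mul_le_mul_of_nonneg_left (hN.trans this) (show 0 ≤ AA / 2 by positivity)
      have e : AA / 2 * (2 / AA * (H + M)) = H + M := by field_simp
      linarith
    classical
    obtain ⟨c, hc1, hc2⟩ : ∃ c : ℕ, H ≤ HH (2*(c+1)+1) - om (2*(c+1)+1) ∧ HH (2*c+1) - om (2*c+1) < H := by
      have h0 : Nat.find hex ≠ 0 := by
        intro h0
        have := Nat.find_spec hex
        rw [h0] at this
        simp only [mul_zero, zero_add] at this
        rw [HH_one, om_one] at this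
        linarith
      obtain ⟨c, hc⟩ := Nat.exists_eq_succ_of_ne_zero h0
      refine ⟨c, ?_, ?_⟩
      · have := Nat.find_spec hex
        rw [hc] at this
        exact this
      · have := Nat.find_min hex (m := c) (by omega)
        linarith
    refine ⟨c+1, hc1, hgood H _ hH3 (by omega) ?_⟩
    obtain ⟨t, et⟩ : ∃ t : ℕ, t = 2*c+1 := ⟨_, rfl⟩
    have tp : 0 < t := by omega
    rw [show 2*(c+1)+1 = (2*c+1)+2 by ring] at hc1 ⊢
    rw [← et] at hc1 hc2 ⊢
    have t1 : (1:ℝ) ≤ t := by exact_mod_cast tp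
    have a1 := (abs_le.mp (hH t tp)).1
    have a2 := (abs_le.mp (hH (t+2) (by omega))).2
    have om1 := om_mono tp (show t ≤ t+2 by omega)
    have og := om_ge t tp
    have og2 := om_ge (t+2) (by omega)
    have o0 : 0 ≤ om t := le_trans (by positivity) og
    have o02 : 0 ≤ om (t+2) := le_trans (by positivity) og2
    push_cast at a2 ⊢
    have a3 : ((t:ℝ)+2)^3 ≤ (t:ℝ)^3 + 26 * om (t+2) := by push_cast at og2; nlinarith
    have a4 := mul_le_mul_of_nonneg_left a3 A0.le
    have a5 := mul_le_mul_of_nonneg_left om1 (by linarith : 0 ≤ C + 1)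
    have a6 : 0 ≤ AA * om (t+2) := by positivity
    have a7 : 0 ≤ C * om (t+2) := by positivity
    rw [abs_le]
    constructor <;> nlinarith

theorem cg_pos : 0 < cg := by
  have := zeta3_ge
  unfold cg
  have : 0 < Real.pi ^ 2 / (2 * zeta3) := by have := Real.pi_pos; positivity
  positivity

theorem cg_cube : AA * cg ^ 3 = 1 := by
  have hz := zeta3_ge
  have h0 : 0 < Real.pi ^ 2 / (2 * zeta3) := by have := Real.pi_pos; positivity
  have : cg ^ 3 = Real.pi ^ 2 / (2 * zeta3) := by
    unfold cg
    rw [← Real.rpow_natCast, ← Real.rpow_mul h0.le]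
    norm_num
  rw [this]
  unfold AA
  have := Real.pi_pos
  field_simp

theorem small_bounds (D : ℝ) (hD : 1 ≤ D) : ∃ F, 1 ≤ F ∧ ∀ (H h : ℝ) (t : ℕ), 3 ≤ H → 0 < h → h ^ 3 = H →
    0 < t → Good D H t →
    om t ≤ F * (h ^ 2 * Real.log H) ∧ |cg * h / t - 1| ≤ F * (Real.log H / h) := by
  have lD := Real.log_nonneg hD
  have A0 := AA_pos
  obtain ⟨F1, hF1⟩ : ∃ F1, F1 = D^2 * (2 + Real.log D) := ⟨_, rfl⟩
  obtain ⟨F2, hF2⟩ : ∃ F2, F2 = D^2 * (2 + Real.log D) / AA := ⟨_, rfl⟩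
  have f1 : 0 ≤ F1 := by rw [hF1]; positivity
  have f2 : 0 ≤ F2 := by rw [hF2]; positivity
  refine ⟨1 + F1 + F2, by linarith, fun H h t hH hh he ht hg => ?_⟩
  obtain ⟨g1, g2, g3, g4, g5, g6⟩ := hg
  have t1 : (1:ℝ) ≤ t := by exact_mod_cast ht
  have L1 : 1 ≤ Real.log H := by
    rw [Real.le_log_iff_exp_le (by linarith)]
    have := Real.exp_one_lt_d9
    linarith
  have lt : 1 + Real.log t ≤ (2 + Real.log D) * Real.log H := by
    have l0 := Real.log_nonneg t1
    have := Real.log_le_log (by positivity) g6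
    rw [Real.log_pow, Real.log_mul (by positivity) (by positivity)] at this
    push_cast at this
    nlinarith
  have l0 := Real.log_nonneg t1
  have DD : D ≤ D^3 := by nlinarith [sq_nonneg D, mul_nonneg (by linarith : (0:ℝ) ≤ D - 1) (by positivity : 0 ≤ D)]
  have th : (t:ℝ) ≤ D * h := by
    have : (t:ℝ)^3 ≤ (D * h)^3 := by
      rw [mul_pow, he]
      refine g6.trans ?_
      gcongr
    exact le_of_pow_le_pow_left₀ (by norm_num) (by positivity) this
  have ht' : h ≤ D * t := by
    have : h^3 ≤ (D * t)^3 := by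
      rw [mul_pow, he]
      refine g3.trans ?_
      gcongr
    exact le_of_pow_le_pow_left₀ (by norm_num) (by positivity) this
  have L0 : 0 ≤ Real.log H := by linarith
  constructor
  · calc om t = (t:ℝ)^2 * (1 + Real.log t) := rfl
      _ ≤ (D * h)^2 * ((2 + Real.log D) * Real.log H) := by gcongr
      _ = F1 * (h^2 * Real.log H) := by rw [hF1]; ring
      _ ≤ _ := by gcongr; linarith
  · have cp := cg_pos
    obtain ⟨u, hu⟩ : ∃ u, u = cg * h := ⟨_, rfl⟩
    have u0 : 0 < u := by rw [hu]; positivity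
    have e1 : H = AA * u^3 := by
      rw [hu, mul_pow, ← mul_assoc, cg_cube, one_mul, he]
    rw [← hu]
    rw [e1, ← mul_sub, abs_mul, abs_of_pos A0] at g1
    have e2 : |u^3 - (t:ℝ)^3| = |u - t| * (u^2 + u * t + (t:ℝ)^2) := by
      have e := abs_of_nonneg (by positivity : 0 ≤ u^2 + u * t + (t:ℝ)^2)
      rw [← e, ← abs_mul]
      congr 1
      ring
    have e3 : |u - t| * (t:ℝ)^2 ≤ |u^3 - (t:ℝ)^3| := by
      rw [e2]; gcongr
      have : 0 ≤ u^2 + u * t := by positivity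
      linarith
    have e4 : AA * (|u - t| * (t:ℝ)^2) ≤ D * ((t:ℝ)^2 * (1 + Real.log t)) :=
      (mul_le_mul_of_nonneg_left e3 A0.le).trans g1
    have e5 : AA * |u - t| ≤ D * (1 + Real.log t) := by
      have : (AA * |u - t|) * (t:ℝ)^2 ≤ (D * (1 + Real.log t)) * (t:ℝ)^2 := by linarith
      exact le_of_mul_le_mul_right this (by positivity)
    have e6 : |u / t - 1| = |u - t| / t := by
      rw [← abs_of_pos (show (0:ℝ) < t by linarith), ← abs_div]
      congr 1
      rw [abs_of_pos (show (0:ℝ) < t by linarith)]; field_simp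
    rw [e6, div_le_iff₀ (by positivity)]
    have e7 : |u - t| ≤ D * ((2 + Real.log D) * Real.log H) / AA := by
      rw [le_div_iff₀ A0]
      have : D * (1 + Real.log t) ≤ D * ((2 + Real.log D) * Real.log H) := by gcongr
      linarith
    calc |u - t| ≤ D * ((2 + Real.log D) * Real.log H) / AA := e7
      _ = F2 * (Real.log H / h) * (h / D) := by rw [hF2]; field_simp
      _ ≤ (1 + F1 + F2) * (Real.log H / h) * t := by
        gcongr
        · linarith
        · rw [div_le_iff₀ (by positivity)]; linarith

theorem book (F B0 : ℝ) (hF : 1 ≤ F) (hB0 : 0 ≤ B0) (H h R : ℝ) (t m : ℕ) (hH : 3 ≤ H) (hh : 0 < h)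
    (he : h ^ 3 = H) (hR : 0 < R) (ht : 0 < t) (hm : m = ⌊cg * h * R⌋₊)
    (h1 : om t ≤ F * (h ^ 2 * Real.log H)) (h2 : |cg * h / t - 1| ≤ F * (Real.log H / h)) :
    (∃ r : ℕ, m ≤ t * r ∧
      r + 2 * (B0 * om t) + 1 ≤ R + (F + 2 * B0 * F + 3) * ((R / h + h ^ 2) * Real.log H)) ∧
    (∃ r : ℕ, t * r ≤ m ∧
      R - (F + 2 * B0 * F + 3) * ((R / h + h ^ 2) * Real.log H) ≤ r - 2 * (B0 * om t) - 1) := by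
  have t1 : (1:ℝ) ≤ t := by exact_mod_cast ht
  have cp := cg_pos
  have L1 : 1 ≤ Real.log H := by
    rw [Real.le_log_iff_exp_le (by linarith)]
    have := Real.exp_one_lt_d9
    linarith
  have hge1 : 1 ≤ h := by
    by_contra hlt
    push Not at hlt
    have : h^3 ≤ 1 := pow_le_one₀ hh.le hlt.le
    linarith
  have m1 : (m:ℝ) ≤ cg * h * R := by rw [hm]; exact Nat.floor_le (by positivity)
  have m2 : cg * h * R < m + 1 := by rw [hm]; exact Nat.lt_floor_add_one _
  have e1 : cg * h * R / t = R * (cg * h / t) := by ring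
  obtain ⟨v, hv⟩ : ∃ v, v = cg * h / t := ⟨_, rfl⟩
  rw [← hv] at h2 e1
  have L2 : 1 ≤ h^2 * Real.log H := by nlinarith [sq_nonneg h]
  have a1 : R * v ≤ R + F * (R / h * Real.log H) := by
    have := mul_le_mul_of_nonneg_left (abs_le.mp h2).2 hR.le
    have e : R * (F * (Real.log H / h)) = F * (R / h * Real.log H) := by ring
    linarith
  have a2 : R - F * (R / h * Real.log H) ≤ R * v := by
    have := mul_le_mul_of_nonneg_left (abs_le.mp h2).1 hR.le
    have e : R * (F * (Real.log H / h)) = F * (R / h * Real.log H) := by ring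
    linarith
  have a3 : B0 * om t ≤ B0 * F * (h^2 * Real.log H) := by
    rw [mul_assoc]; gcongr
  obtain ⟨x, hx⟩ : ∃ x, x = R / h * Real.log H := ⟨_, rfl⟩
  obtain ⟨y, hy⟩ : ∃ y, y = h^2 * Real.log H := ⟨_, rfl⟩
  have x0 : 0 ≤ x := by rw [hx]; positivity
  have ee : (R / h + h ^ 2) * Real.log H = x + y := by rw [hx, hy]; ring
  rw [ee]
  rw [← hx] at a1 a2
  rw [← hy] at a3 L2
  have p1 : 0 ≤ B0 * F * x := by positivity
  have p2 : 0 ≤ F * y := by positivity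
  constructor
  · refine ⟨⌈(m:ℝ) / t⌉₊, ?_, ?_⟩
    · have := Nat.le_ceil ((m:ℝ) / t)
      rw [div_le_iff₀ (by linarith)] at this
      have : (m:ℝ) ≤ ((t * ⌈(m:ℝ) / t⌉₊ : ℕ) : ℝ) := by push_cast; linarith
      exact_mod_cast this
    · have b := Nat.ceil_lt_add_one (show 0 ≤ (m:ℝ) / t by positivity)
      have b2 : (m:ℝ) / t ≤ R * v := by rw [← e1]; gcongr
      linarith
  · refine ⟨m / t, Nat.mul_div_le m t, ?_⟩
    have b1 : (m:ℝ) + 1 ≤ t * ((m / t : ℕ) + 1) := by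
      have := Nat.lt_mul_div_succ m ht
      exact_mod_cast this
    have b2 : R * v ≤ (m / t : ℕ) + 1 := by
      rw [← e1, div_le_iff₀ (by linarith)]; linarith
    linarith

theorem master : ∃ C : ℝ, 0 < C ∧ ∀ (H h R : ℝ) (m : ℕ), 3 ≤ H → 0 < h → h ^ 3 = H → 0 < R →
    m = ⌊cg * h * R⌋₊ →
    (∃ (c r : ℕ) (B : ℝ), m ≤ (2*c+1) * r ∧
      r + 2 * B + 1 ≤ R + C * ((R / h + h ^ 2) * Real.log H) ∧
      ∀ θ : ℝ, 0 ≤ θ → θ ≤ 1 →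
        (∀ z ∈ W0 c, ((z.1:ℝ) - θ)^2 / (2*H) - B ≤ z.2) ∧
        (∀ z : ℤ × ℤ, |(z.1:ℝ)| ≤ H → ((z.1:ℝ) - θ)^2 / (2*H) + B ≤ z.2 → z ∈ W0 c)) ∧
    (∃ (c r : ℕ) (B : ℝ), (2*c+1) * r ≤ m ∧
      R - C * ((R / h + h ^ 2) * Real.log H) ≤ r - 2 * B - 1 ∧
      ∀ θ : ℝ, 0 ≤ θ → θ ≤ 1 →
        (∀ z : ℤ × ℤ, ((z.1:ℝ) - θ)^2 / (2*H) + B ≤ z.2 → z ∈ W0 c) ∧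
        (∀ z ∈ W0 c, |(z.1:ℝ)| ≤ H → ((z.1:ℝ) - θ)^2 / (2*H) - B ≤ z.2)) := by
  obtain ⟨D₁, hD₁, hmodel⟩ := model
  obtain ⟨D₂, hD₂, hpar⟩ := params
  obtain ⟨F, hF, hsm⟩ := small_bounds D₂ hD₂
  obtain ⟨D, hD⟩ : ∃ D, D = D₁ + D₂ := ⟨_, rfl⟩
  have D1 : 1 ≤ D := by linarith
  have P2 : 0 ≤ D ^ 2 := by positivity
  have P3 : 0 ≤ D ^ 3 := by positivity
  obtain ⟨B0, hB0⟩ : ∃ B0, B0 = 5 * D^2 + 3 * D^3 + 7 * D := ⟨_, rfl⟩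
  have B00 : 0 ≤ B0 := by rw [hB0]; positivity
  refine ⟨F + 2 * B0 * F + 3, by positivity, fun H h R m hH hh he hR hm => ?_⟩
  obtain ⟨⟨c, hc, hg⟩, ⟨c', hc', hg'⟩⟩ := hpar H hH
  constructor
  · obtain ⟨σ, g, w1, w2, w3⟩ := hmodel c
    obtain ⟨s1, s2⟩ := hsm H h (2*c+1) hH hh he (by omega) hg
    obtain ⟨⟨r, r1, r2⟩, -⟩ := book F B0 hF B00 H h R (2*c+1) m hH hh he hR (by omega) hm s1 s2
    obtain ⟨t, et⟩ : ∃ t : ℕ, t = 2*c+1 := ⟨_, rfl⟩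
    rw [← et] at hc hg w2 w3 r1 r2
    have tp : 0 < t := by omega
    have t1 : (1:ℝ) ≤ t := by exact_mod_cast tp
    have og := om_ge t tp
    have o1 : 1 ≤ om t := le_trans (by nlinarith) og
    have K1 := HH_ge_one t tp
    obtain ⟨g1, g2, g3, g4, g5, g6⟩ := hg
    have lift : ∀ a b : ℝ, 0 ≤ b → a ≤ D₂ * b → a ≤ D * b := fun a b hb hab =>
      hab.trans (by gcongr; linarith)
    have hE : D₁ * om t ≤ D * om t := by gcongr; linarith
    refine ⟨c, r, B0 * om t, by rw [← et]; exact r1, r2, fun θ h0 h1 => ⟨fun z hz => ?_, fun z hx hz => ?_⟩⟩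
    · obtain ⟨j, hj⟩ := w3 (z.1 / H)
      have := inclA D (D₁ * om t) (om t) (HH t) H t θ (σ j) (g j) z.1 z.2 D1 o1 (by positivity) hE t1 og hH
        (lift _ _ (by positivity) g3) hc h0 h1 (w2 j) hj ((w1 z).mp hz j)
      have : 5 * D^2 * om t ≤ B0 * om t := by gcongr; linarith
      linarith
    · rw [w1]
      intro j
      refine inclB D (D₁ * om t) (om t) (HH t) H θ (σ j) (g j) z.1 z.2 D1 o1 (by positivity) hE
        (by linarith) hH (by linarith) ?_ (lift _ _ (by linarith) g4) (lift _ _ (by linarith) g5) h0 h1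
        (w2 j) hx ?_
      · exact lift _ _ (by linarith) ((le_abs_self _).trans g2)
      · have : 3 * D^3 * om t ≤ B0 * om t := by gcongr; linarith
        linarith
  · obtain ⟨σ, g, w1, w2, w3⟩ := hmodel c'
    obtain ⟨s1, s2⟩ := hsm H h (2*c'+1) hH hh he (by omega) hg'
    obtain ⟨-, ⟨r, r1, r2⟩⟩ := book F B0 hF B00 H h R (2*c'+1) m hH hh he hR (by omega) hm s1 s2
    obtain ⟨t, et⟩ : ∃ t : ℕ, t = 2*c'+1 := ⟨_, rfl⟩
    rw [← et] at hc' hg' w2 w3 r1 r2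
    have tp : 0 < t := by omega
    have t1 : (1:ℝ) ≤ t := by exact_mod_cast tp
    have og := om_ge t tp
    have o1 : 1 ≤ om t := le_trans (by nlinarith) og
    have K1 := HH_ge_one t tp
    obtain ⟨g1, g2, g3, g4, g5, g6⟩ := hg'
    have lift : ∀ a b : ℝ, 0 ≤ b → a ≤ D₂ * b → a ≤ D * b := fun a b hb hab =>
      hab.trans (by gcongr; linarith)
    have hE : D₁ * om t ≤ D * om t := by gcongr; linarith
    refine ⟨c', r, B0 * om t, by rw [← et]; exact r1, r2, fun θ h0 h1 => ⟨fun z hz => ?_, fun z hz hx => ?_⟩⟩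
    · rw [w1]
      intro j
      refine inclC D (D₁ * om t) (om t) (HH t) H θ (σ j) (g j) z.1 z.2 D1 o1 (by positivity) hE
        hH hc' h0 h1 (w2 j) ?_
      have : 2 * D^2 * om t ≤ B0 * om t := by gcongr; linarith
      linarith
    · obtain ⟨j, hj⟩ := w3 (z.1 / H)
      have := inclD D (D₁ * om t) (om t) (HH t) H t θ (σ j) (g j) z.1 z.2 D1 o1 (by positivity) hE t1 og hH
        (lift _ _ (by positivity) g3) (by linarith)
        (lift _ _ (by linarith) (by have := (abs_le.mp g2).1; linarith)) h0 h1 (w2 j) hj hx ((w1 z).mp hz j)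
      have : 7 * D * om t ≤ B0 * om t := by gcongr; linarith
      linarith

theorem par_conv (a b c H θ : ℝ) (n : ℕ) (w1 w2 k : ℤ) (z : ℤ × ℤ) (ha : 0 < a) (hn : 0 < n)
    (hH : H = n / a) (hθ : θ = k * H - b * H - w1) :
    n * ((EE n w1 w2 k z).2 - (a * (EE n w1 w2 k z).1 ^ 2 / 2 + b * (EE n w1 w2 k z).1 + c)) =
      z.2 - (z.1 - θ) ^ 2 / (2 * H) - (c * n - b ^ 2 * H / 2 - k * θ + k ^ 2 * H / 2 - w2) := by
  have n0 : (0:ℝ) < n := by exact_mod_cast hn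
  have H0 : 0 < H := by rw [hH]; positivity
  have hnn : (n:ℝ) = a * H := by rw [hH]; field_simp
  have hw : (w1:ℝ) = k * H - b * H - θ := by linarith
  unfold EE
  simp only
  push_cast
  rw [hw, hnn]
  field_simp
  ring

theorem EE_surj (n : ℕ) (w1 w2 k i j : ℤ) :
    ((i:ℝ)/n, (j:ℝ)/n) = EE n w1 w2 k (i - w1, j - k * (i - w1) - w2) := by
  unfold EE
  simp only
  congr 3 <;> ring

theorem EE_mem_grid (n : ℕ) (w1 w2 k : ℤ) (z : ℤ × ℤ) : EE n w1 w2 k z ∈ gridN n :=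
  ⟨_, _, rfl⟩

theorem peel_iter_sub (U : Set (ℝ × ℝ)) (m : ℕ) : peel^[m] U ⊆ U := by
  induction m with
  | zero => exact subset_rfl
  | succ m ih => rw [Function.iterate_succ_apply']; exact Set.sdiff_subset.trans ih

theorem local_frame (b H : ℝ) (hH : 3 ≤ H) (i : ℤ) : ∃ (k w1 : ℤ) (θ : ℝ),
    θ = k * H - b * H - w1 ∧ 0 ≤ θ ∧ θ ≤ 1 ∧ |((i - w1 : ℤ) : ℝ)| ≤ H := by
  have H0 : 0 < H := by linarith
  obtain ⟨k, hk⟩ : ∃ k, k = round ((i + b * H) / H) := ⟨_, rfl⟩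
  refine ⟨k, ⌊k * H - b * H⌋, k * H - b * H - ⌊k * H - b * H⌋, rfl, ?_, ?_, ?_⟩
  · have := Int.floor_le (k * H - b * H); linarith
  · have := Int.lt_floor_add_one (k * H - b * H); linarith
  · have h1 := Int.floor_le (k * H - b * H)
    have h2 := Int.lt_floor_add_one (k * H - b * H)
    have h3 := abs_sub_round ((i + b * H) / H)
    rw [← hk] at h3
    have e : (i + b * H) / H - k = (i + b * H - k * H) / H := by field_simp
    rw [e, abs_div, abs_of_pos H0, div_le_iff₀ H0, abs_le] at h3
    push_cast
    rw [abs_le]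
    constructor <;> linarith

theorem scaling (a T : ℝ) (n : ℕ) (ha : 0 < a) (hn : 0 < n) (C : ℝ) :
    ∃ h : ℝ, 0 < h ∧ h ^ 3 = n / a ∧
      cg * T * (n : ℝ) ^ ((4 : ℝ) / 3) = cg * h * (T * a ^ ((1 : ℝ) / 3) * n) ∧
      n * (C * (T * a ^ ((2 : ℝ) / 3) + a ^ (-(2 : ℝ) / 3)) *
                Real.log ((n : ℝ) / a) / (n : ℝ) ^ ((1 : ℝ) / 3)) =
      C * (((T * a ^ ((1 : ℝ) / 3) * n) / h + h ^ 2) * Real.log ((n:ℝ) / a)) := by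
  have n0 : (0:ℝ) < n := by exact_mod_cast hn
  obtain ⟨α, hα⟩ : ∃ α, α = a ^ ((1:ℝ)/3) := ⟨_, rfl⟩
  obtain ⟨ν, hν⟩ : ∃ ν, ν = (n:ℝ) ^ ((1:ℝ)/3) := ⟨_, rfl⟩
  have α0 : 0 < α := by rw [hα]; positivity
  have ν0 : 0 < ν := by rw [hν]; positivity
  have e1 : α ^ 3 = a := by
    rw [hα, ← Real.rpow_natCast, ← Real.rpow_mul ha.le]; norm_num
  have e2 : ν ^ 3 = n := by
    rw [hν, ← Real.rpow_natCast, ← Real.rpow_mul n0.le]; norm_num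
  have e3 : (n:ℝ) ^ ((4:ℝ)/3) = ν ^ 4 := by
    rw [hν, ← Real.rpow_natCast, ← Real.rpow_mul n0.le]; norm_num
  have e4 : a ^ ((2:ℝ)/3) = α ^ 2 := by
    rw [hα, ← Real.rpow_natCast, ← Real.rpow_mul ha.le]; norm_num
  have e5 : a ^ (-(2:ℝ)/3) = (α ^ 2)⁻¹ := by
    rw [← e4, ← Real.rpow_neg ha.le]; norm_num
  refine ⟨ν / α, by positivity, ?_, ?_, ?_⟩
  · rw [div_pow, e1, e2]
  · rw [e3, ← hα, ← e2]; field_simp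
  · rw [e4, e5, ← hα, ← hν]
    obtain ⟨L, hL⟩ : ∃ L, L = Real.log ((n:ℝ)/a) := ⟨_, rfl⟩
    rw [← hL, ← e2]; field_simp

/-- Grid peeling for m = ⌊c_g·T·n^{4/3}⌋ steps on a grid of spacing 1/n,
started at the parabola y = a·x²/2 + b·x + c, tracks the affine
curve-shortening flow, the translate of the parabola by T·a^{1/3} upward,
up to the vertical error ε. -/
theorem grid_peeling_parabola_ACSF :
    ∃ C : ℝ, 0 < C ∧
      ∀ (a b c T : ℝ) (n : ℕ), 0 < a → 0 < T → 3 ≤ n → 3 * a ≤ (n : ℝ) →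
        ∀ m : ℕ, m = ⌊cg * T * (n : ℝ) ^ ((4 : ℝ) / 3)⌋₊ →
        ∀ ε : ℝ,
          ε = C * (T * a ^ ((2 : ℝ) / 3) + a ^ (-(2 : ℝ) / 3)) *
                Real.log ((n : ℝ) / a) / (n : ℝ) ^ ((1 : ℝ) / 3) →
          (∀ p ∈ gridN n,
            a * p.1 ^ 2 / 2 + b * p.1 + c + T * a ^ ((1 : ℝ) / 3) + ε ≤ p.2 →
              p ∈ peel^[m] (parabGrid a b c n)) ∧
          (∀ p ∈ peel^[m] (parabGrid a b c n),
            a * p.1 ^ 2 / 2 + b * p.1 + c + T * a ^ ((1 : ℝ) / 3) - ε ≤ p.2) := by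
  obtain ⟨C, hC, hmaster⟩ := master
  refine ⟨C, hC, fun a b c T n ha hT hn3 hna m hm ε hε => ?_⟩
  have hn : 0 < n := by omega
  have n0 : (0:ℝ) < n := by exact_mod_cast hn
  obtain ⟨h, h0, h3, hs1, hs2⟩ := scaling a T n ha hn C
  rw [← hε] at hs2
  obtain ⟨H, hH⟩ : ∃ H, H = (n:ℝ) / a := ⟨_, rfl⟩
  rw [← hH] at h3 hs2
  obtain ⟨R, hR⟩ : ∃ R, R = T * a ^ ((1 : ℝ) / 3) * n := ⟨_, rfl⟩
  rw [← hR] at hs1 hs2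
  have R0 : 0 < R := by rw [hR]; positivity
  have H3 : 3 ≤ H := by rw [hH, le_div_iff₀ ha]; exact hna
  rw [hs1] at hm
  obtain ⟨⟨c₁, r₁, B₁, p1, p2, p3⟩, ⟨c₂, r₂, B₂, q1, q2, q3⟩⟩ := hmaster H h R m H3 h0 h3 R0 hm
  rw [← hs2] at p2 q2
  constructor
  · rintro p ⟨i, j, rfl⟩ hp
    obtain ⟨k, w1, θ, hθ, θ0, θ1, hi⟩ := local_frame b H H3 i
    obtain ⟨P3, P4⟩ := p3 θ θ0 θ1
    obtain ⟨Y, hY⟩ : ∃ Y, Y = c * n - b ^ 2 * H / 2 - k * θ + k ^ 2 * H / 2 := ⟨_, rfl⟩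
    obtain ⟨w2, hw2⟩ : ∃ w2, w2 = ⌈Y + B₁⌉ := ⟨_, rfl⟩
    have y1 := Int.le_ceil (Y + B₁)
    have y2 := Int.ceil_lt_add_one (Y + B₁)
    rw [← hw2] at y1 y2
    rw [EE_surj n w1 w2 k i j] at hp ⊢
    obtain ⟨z, hz⟩ : ∃ z : ℤ × ℤ, z = (i - w1, j - k * (i - w1) - w2) := ⟨_, rfl⟩
    have hz1 : |(z.1:ℝ)| ≤ H := by rw [hz]; exact hi
    rw [← hz] at hp ⊢
    have conv := fun z => par_conv a b c H θ n w1 w2 k z ha hn hH hθ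
    rw [← hY] at conv
    have sub : EE n w1 w2 k '' W0 c₁ ⊆ parabGrid a b c n := by
      rintro _ ⟨z, hz, rfl⟩
      refine ⟨EE_mem_grid _ _ _ _ _, ?_⟩
      have := conv z
      have := P3 z hz
      have : 0 ≤ n * ((EE n w1 w2 k z).2 - (a * (EE n w1 w2 k z).1 ^ 2 / 2 + b * (EE n w1 w2 k z).1 + c)) := by
        linarith
      have := nonneg_of_mul_nonneg_right this n0
      linarith
    apply peel_iter_mono sub m
    refine peel_lower (cchain c₁ (by positivity)) hn w1 w2 k (t := 2*c₁+1) (by push_cast; ring) m r₁ p1 z ?_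
    apply P4 (z.1, z.2 - (r₁:ℤ)) hz1
    have c1 := conv z
    have hp2 : T * a ^ ((1 : ℝ) / 3) + ε ≤ (EE n w1 w2 k z).2 - (a * (EE n w1 w2 k z).1 ^ 2 / 2 + b * (EE n w1 w2 k z).1 + c) := by
      linarith
    have := mul_le_mul_of_nonneg_left hp2 n0.le
    rw [c1] at this
    push_cast
    linarith
  · intro p hp
    obtain ⟨i, j, rfl⟩ := (peel_iter_sub _ m hp).1
    obtain ⟨k, w1, θ, hθ, θ0, θ1, hi⟩ := local_frame b H H3 i
    obtain ⟨P3, P4⟩ := q3 θ θ0 θ1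
    obtain ⟨Y, hY⟩ : ∃ Y, Y = c * n - b ^ 2 * H / 2 - k * θ + k ^ 2 * H / 2 := ⟨_, rfl⟩
    obtain ⟨w2, hw2⟩ : ∃ w2, w2 = ⌊Y - B₂⌋ := ⟨_, rfl⟩
    have y1 := Int.floor_le (Y - B₂)
    have y2 := Int.lt_floor_add_one (Y - B₂)
    rw [← hw2] at y1 y2
    rw [EE_surj n w1 w2 k i j] at hp ⊢
    obtain ⟨z, hz⟩ : ∃ z : ℤ × ℤ, z = (i - w1, j - k * (i - w1) - w2) := ⟨_, rfl⟩
    have hz1 : |(z.1:ℝ)| ≤ H := by rw [hz]; exact hi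
    rw [← hz] at hp ⊢
    have conv := fun z => par_conv a b c H θ n w1 w2 k z ha hn hH hθ
    rw [← hY] at conv
    have sub : parabGrid a b c n ⊆ EE n w1 w2 k '' W0 c₂ := by
      rintro p ⟨⟨i, j, rfl⟩, hp⟩
      rw [EE_surj n w1 w2 k i j] at hp ⊢
      obtain ⟨z, hz⟩ : ∃ z : ℤ × ℤ, z = (i - w1, j - k * (i - w1) - w2) := ⟨_, rfl⟩
      rw [← hz] at hp ⊢
      refine ⟨z, P3 z ?_, rfl⟩
      have c1 := conv z
      have hp2 : 0 ≤ (EE n w1 w2 k z).2 - (a * (EE n w1 w2 k z).1 ^ 2 / 2 + b * (EE n w1 w2 k z).1 + c) := by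
        linarith
      have := mul_nonneg n0.le hp2
      rw [c1] at this
      linarith
    have hp' := peel_iter_mono sub m hp
    have := peel_upper (cchain c₂ (by positivity)) hn w1 w2 k (t := 2*c₂+1) (by push_cast; ring) m r₂ q1 z hp'
    have := P4 (z.1, z.2 - (r₂:ℤ)) this hz1
    push_cast at this
    have c1 := conv z
    have : 0 ≤ n * ((EE n w1 w2 k z).2 - (a * (EE n w1 w2 k z).1 ^ 2 / 2 + b * (EE n w1 w2 k z).1 + c + T * a ^ ((1 : ℝ) / 3) - ε)) := by
      linarith
    have := nonneg_of_mul_nonneg_right this n0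
    linarith
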